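/- arXiv:2506.14031 — 2 statements merged into one kernel-verified Lean document; each statement's English description precedes it below -/
import Mathlib

section
/- Suppose [·,·] is a Lie bracket on ℝ^7 and Λ : ℝ^7 → 𝔤𝔩(7,ℝ) is a linear map with Λ(x)y − Λ(y)x = [x,y] and Λ(x) ∈ 𝔥^III for all x,y ∈ ℝ^7. Write Λ(e_i) = h(A_i, v_i, (y_{i1},y_{i2})) with A_i = (a_{i1}, a_{i2}; a_{i3}, a_{i4}). If the subalgebra span{e_1,e_2,e_3} is not abelian (i.e. [e_i,e_j] ≠ 0 for some i,j ∈ {1,2,3}), then the infinitesimal holonomy 𝔥 is decomposable, or a_{i3} = 0 for all i = 1,…,7 (all A_i upper triangular), or a_{i2} = 0 for all i = 1,…,7 (all A_i lower triangular). -/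
open Matrix

noncomputable section

abbrev V7 : Type := Fin 7 → ℝ
abbrev M7 : Type := Matrix (Fin 7) (Fin 7) ℝ
abbrev M2 : Type := Matrix (Fin 2) (Fin 2) ℝ

/-- The standard basis of `ℝ^7` (0-indexed: `e 0` is `e_1` of the paper). -/
def e (i : Fin 7) : V7 := Pi.single i 1

/-- The symmetric bilinear form of signature (4,3):
`⟨e_1,e_5⟩ = ⟨e_2,e_6⟩ = ⟨e_3,e_7⟩ = 1`, `⟨e_4,e_4⟩ = −1`. -/
def ip (u v : V7) : ℝ :=
  u 0 * v 4 + u 4 * v 0 + u 1 * v 5 + u 5 * v 1 + u 2 * v 6 + u 6 * v 2 - u 3 * v 3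

/-- The matrix `h(A,v,u,y)`. -/
def hmat (A : M2) (v : ℝ) (u y : Fin 2 → ℝ) : M7 :=
  !![A 0 0 + A 1 1, -u 1, u 0, Real.sqrt 2 * v, 0, -y 0, -y 1;
     0, A 0 0, A 0 1, Real.sqrt 2 * u 0, y 0, 0, v;
     0, A 1 0, A 1 1, Real.sqrt 2 * u 1, y 1, -v, 0;
     0, 0, 0, 0, Real.sqrt 2 * v, Real.sqrt 2 * u 0, Real.sqrt 2 * u 1;
     0, 0, 0, 0, -(A 0 0 + A 1 1), 0, 0;
     0, 0, 0, 0, u 1, -A 0 0, -A 1 0;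
     0, 0, 0, 0, -u 0, -A 0 1, -A 1 1]

/-- `𝔥^I = {h(A,v,u,y)}`. -/
def hI : Set M7 := {X | ∃ A v u y, X = hmat A v u y}

/-- The matrix `h(A,v,y) := h(A,v,0,y)`. -/
def h3 (A : M2) (v : ℝ) (y : Fin 2 → ℝ) : M7 := hmat A v 0 y

/-- `𝔥^III = {h(A,v,y)}`. -/
def hIII : Set M7 := {X | ∃ A v y, X = h3 A v y}

/-- `𝔪(1,0,1) = {h(0,v,(y_1,0))}`. -/
def m101 : Set M7 := {X | ∃ v y1, X = h3 0 v ![y1, 0]}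

/-- `𝔪(1,0,2) = {h(0,v,(y_1,y_2))}`. -/
def m102 : Set M7 := {X | ∃ v y, X = h3 0 v y}

/-- The projection `pro_A` (reading off the relevant entries; on `𝔥^III` and `𝔥^I`
it gives the `𝔤𝔩(2,ℝ)`-component `A`). -/
def proA (X : M7) : M2 := !![X 1 1, X 1 2; X 2 1, X 2 2]

/-- The projection `pro_v` (on `𝔥^III` and `𝔥^I` it gives the component `v`). -/
def proV (X : M7) : ℝ := X 1 6

/-- The curvature `R(x,y) = Λ(x)Λ(y) − Λ(y)Λ(x) − Λ([x,y])`. -/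
def curv (L : V7 →ₗ[ℝ] M7) (bk : V7 → V7 → V7) (x y : V7) : M7 :=
  L x * L y - L y * L x - L (bk x y)

/-- The infinitesimal holonomy: the smallest linear subspace of `𝔤𝔩(7,ℝ)` containing
all `R(x,y)` and stable under bracketing with all `Λ(z)`. -/
def infHol (L : V7 →ₗ[ℝ] M7) (bk : V7 → V7 → V7) : Submodule ℝ M7 :=
  sInf {H : Submodule ℝ M7 | (∀ x y, curv L bk x y ∈ H) ∧
    ∀ z : V7, ∀ X ∈ H, L z * X - X * L z ∈ H}

/-- A set of matrices is decomposable if some nontrivial proper subspace `W` is invariant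
and the restriction of `⟨·,·⟩` to `W` is nondegenerate. -/
def Decomposable (H : Set M7) : Prop :=
  ∃ W : Submodule ℝ V7, W ≠ ⊥ ∧ W ≠ ⊤ ∧
    (∀ X ∈ H, ∀ w ∈ W, X.mulVec w ∈ W) ∧
    (∀ w ∈ W, (∀ w' ∈ W, ip w w' = 0) → w = 0)

set_option linter.unusedSimpArgs false

/-- Entries of a member of `𝔥^III` in terms of its coefficients. -/
theorem eq_h3_of_mem {X : M7} (hX : X ∈ hIII) :
    X = h3 !![X 1 1, X 1 2; X 2 1, X 2 2] (X 1 6) ![X 1 4, X 2 4] := by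
  obtain ⟨A, v, y, rfl⟩ := hX
  ext i j
  fin_cases i <;> fin_cases j <;> simp [h3, hmat]

set_option maxHeartbeats 2000000 in
theorem h3_comm (A : M2) (v : ℝ) (y : Fin 2 → ℝ) (A' : M2) (v' : ℝ) (y' : Fin 2 → ℝ) :
    h3 A v y * h3 A' v' y' - h3 A' v' y' * h3 A v y =
      h3 (A * A' - A' * A) (A.trace * v' - A'.trace * v)
        ![(2 * A 0 0 + A 1 1) * y' 0 + A 0 1 * y' 1 - ((2 * A' 0 0 + A' 1 1) * y 0 + A' 0 1 * y 1),
          A 1 0 * y' 0 + (A 0 0 + 2 * A 1 1) * y' 1 -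
            (A' 1 0 * y 0 + (A' 0 0 + 2 * A' 1 1) * y 1)] := by
  ext i j
  simp only [Matrix.sub_apply, h3, hmat, Matrix.trace_fin_two]
  fin_cases i <;> fin_cases j <;>
    simp [Matrix.mul_apply, Fin.sum_univ_succ] <;> ring

theorem h3_sub (A : M2) (v : ℝ) (y : Fin 2 → ℝ) (A' : M2) (v' : ℝ) (y' : Fin 2 → ℝ) :
    h3 A v y - h3 A' v' y' = h3 (A - A') (v - v') (y - y') := by
  ext i j
  fin_cases i <;> fin_cases j <;> simp [h3, hmat] <;> ring

theorem ip_mulVec_skew {X : M7} (hX : X ∈ hIII) (u w : V7) :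
    ip (X.mulVec u) w = -ip (X.mulVec w) u := by
  obtain ⟨A, v, y, rfl⟩ := hX
  simp [ip, h3, hmat, Matrix.mulVec, dotProduct, Fin.sum_univ_seven]
  ring

/-- A connection with values in `𝔥^III` and its bracket. -/
structure IsConn (bk : V7 → V7 → V7) (L : V7 →ₗ[ℝ] M7) : Prop where
  torsion : ∀ x y : V7, (L x).mulVec y - (L y).mulVec x = bk x y
  jacobi : ∀ x y z : V7, bk (bk x y) z + bk (bk y z) x + bk (bk z x) y = 0
  mem : ∀ x, L x ∈ hIII

namespace IsConn

variable {bk : V7 → V7 → V7} {L : V7 →ₗ[ℝ] M7}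

theorem bk_swap (H : IsConn bk L) (x y : V7) : bk y x = -bk x y := by
  rw [← H.torsion, ← H.torsion, neg_sub]

theorem curv_mem (H : IsConn bk L) (x y : V7) : curv L bk x y ∈ hIII := by
  rw [curv, eq_h3_of_mem (H.mem (bk x y)), eq_h3_of_mem (H.mem x), eq_h3_of_mem (H.mem y),
    h3_comm, h3_sub]
  exact ⟨_, _, _, rfl⟩

theorem curv_swap (H : IsConn bk L) (x y : V7) : curv L bk y x = -curv L bk x y := by
  simp only [curv, H.bk_swap x y, map_neg]
  abel

/-- The first Bianchi identity. -/
theorem bianchi (H : IsConn bk L) (x y z : V7) :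
    (curv L bk x y).mulVec z + (curv L bk y z).mulVec x + (curv L bk z x).mulVec y = 0 := by
  have hj := H.jacobi x y z
  simp only [← H.torsion (bk _ _)] at hj
  have h1 : ∀ x y z, (L x).mulVec (bk y z) = (L x).mulVec ((L y).mulVec z) -
      (L x).mulVec ((L z).mulVec y) := fun x y z => by rw [← H.torsion, Matrix.mulVec_sub]
  simp only [curv, Matrix.sub_mulVec, ← Matrix.mulVec_mulVec, h1] at hj ⊢
  rw [← neg_eq_zero, ← hj]
  abel

/-- The second Bianchi identity. -/
theorem bianchi₂ (H : IsConn bk L) (x y z : V7) :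
    (L x * curv L bk y z - curv L bk y z * L x - curv L bk (bk x y) z) +
    (L y * curv L bk z x - curv L bk z x * L y - curv L bk (bk y z) x) +
    (L z * curv L bk x y - curv L bk x y * L z - curv L bk (bk z x) y) = 0 := by
  have hj : L (bk (bk x y) z) + L (bk (bk y z) x) + L (bk (bk z x) y) = 0 := by
    rw [← map_add, ← map_add, H.jacobi, map_zero]
  simp only [curv]
  rw [← hj]
  noncomm_ring

/-- The pair symmetry of the curvature. -/
theorem curv_pair (H : IsConn bk L) (x y z w : V7) :
    ip ((curv L bk x y).mulVec z) w = ip ((curv L bk z w).mulVec x) y := by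
  have hb : ∀ x y z w, ip ((curv L bk x y).mulVec z) w + ip ((curv L bk y z).mulVec x) w +
      ip ((curv L bk z x).mulVec y) w = 0 := by
    intro x y z w
    have h := congrArg (ip · w) (H.bianchi x y z)
    simp only [ip, Pi.add_apply, Pi.zero_apply] at h ⊢
    linarith
  have hs : ∀ x y z w, ip ((curv L bk y x).mulVec z) w = -ip ((curv L bk x y).mulVec z) w := by
    intro x y z w
    rw [H.curv_swap x y, Matrix.neg_mulVec]
    simp only [ip, Pi.neg_apply]
    ring
  have hk : ∀ x y z w, ip ((curv L bk x y).mulVec w) z = -ip ((curv L bk x y).mulVec z) w :=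
    fun x y z w => ip_mulVec_skew (H.curv_mem x y) w z
  linarith [hb x y z w, hb y z w x, hb z w x y, hb w x y z, hs x y z w, hs x z y w, hs y z x w,
    hs x z w y, hs z w x y, hs z w y x, hs y z w x, hs y w z x, hs x w y z, hs x w z y, hs x y w z,
    hs y w x z, hk x y z w, hk x z y w, hk y z x w, hk z w x y, hk x w y z, hk y w x z,
    hk z x y w, hk w x y z, hk w y x z]

end IsConn

/-- The seven coordinates of each of the seven elements `Λ(e_i)` of `𝔥^III`. -/
structure Coeffs where
  (a b c d v p q : Fin 7 → ℝ)

namespace Coeffs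

variable (K : Coeffs)

/-- The element `Λ(e_i)`. -/
def mat (i : Fin 7) : M7 := h3 !![K.a i, K.b i; K.c i, K.d i] (K.v i) ![K.p i, K.q i]

/-- The value on `Λ(e_i) e_j` of the linear form with coordinates `f`. -/
def act (f : Fin 7 → ℝ) (i j : Fin 7) : ℝ :=
  ![(K.a i + K.d i) * f 0, K.a i * f 1 + K.c i * f 2, K.b i * f 1 + K.d i * f 2,
    √2 * K.v i * f 0, K.p i * f 1 + K.q i * f 2 + √2 * K.v i * f 3 - (K.a i + K.d i) * f 4,
    -K.p i * f 0 - K.v i * f 2 - K.a i * f 5 - K.b i * f 6,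
    -K.q i * f 0 + K.v i * f 1 - K.c i * f 5 - K.d i * f 6] j

/-- The value on `[e_i, e_j]` of the linear form with coordinates `f`. -/
def brk (f : Fin 7 → ℝ) (i j : Fin 7) : ℝ := K.act f i j - K.act f j i

def F11 (i j : Fin 7) : ℝ := K.b i * K.c j - K.b j * K.c i - K.brk K.a i j
def F12 (i j : Fin 7) : ℝ :=
  K.a i * K.b j + K.b i * K.d j - K.a j * K.b i - K.b j * K.d i - K.brk K.b i j
def F21 (i j : Fin 7) : ℝ :=
  K.c i * K.a j + K.d i * K.c j - K.c j * K.a i - K.d j * K.c i - K.brk K.c i j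
def F22 (i j : Fin 7) : ℝ := K.c i * K.b j - K.c j * K.b i - K.brk K.d i j
def FV (i j : Fin 7) : ℝ :=
  (K.a i + K.d i) * K.v j - (K.a j + K.d j) * K.v i - K.brk K.v i j
def FP (i j : Fin 7) : ℝ :=
  (2 * K.a i + K.d i) * K.p j + K.b i * K.q j
    - ((2 * K.a j + K.d j) * K.p i + K.b j * K.q i) - K.brk K.p i j
def FQ (i j : Fin 7) : ℝ :=
  K.c i * K.p j + (K.a i + 2 * K.d i) * K.q j
    - (K.c j * K.p i + (K.a j + 2 * K.d j) * K.q i) - K.brk K.q i j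

end Coeffs

theorem mulVec_e (X : M7) (j : Fin 7) : X.mulVec (e j) = X.col j := by
  simp [e]

theorem eq_sum_e (x : V7) : x = ∑ k, x k • e k := by
  ext j
  simp [e, Pi.single_apply]

namespace IsConn

variable {bk : V7 → V7 → V7} {L : V7 →ₗ[ℝ] M7}

/-- The coordinates of a connection. -/
def _root_.coeffs (L : V7 →ₗ[ℝ] M7) : Coeffs where
  a i := L (e i) 1 1
  b i := L (e i) 1 2
  c i := L (e i) 2 1
  d i := L (e i) 2 2
  v i := L (e i) 1 6
  p i := L (e i) 1 4
  q i := L (e i) 2 4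

theorem apply_e (H : IsConn bk L) (i : Fin 7) : L (e i) = (coeffs L).mat i :=
  eq_h3_of_mem (H.mem _)

theorem map_bk (H : IsConn bk L) (f : V7 →ₗ[ℝ] ℝ) (i j : Fin 7) :
    f (bk (e i) (e j)) = (coeffs L).brk (fun k => f (e k)) i j := by
  have key : ∀ i j, f ((L (e i)).mulVec (e j)) = (coeffs L).act (fun k => f (e k)) i j := by
    intro i j
    rw [eq_sum_e ((L (e i)).mulVec (e j)), map_sum]
    simp only [map_smul, smul_eq_mul, Fin.sum_univ_seven, mulVec_e, H.apply_e]
    fin_cases j <;> simp [Coeffs.mat, h3, hmat, Coeffs.act] <;> ring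
  rw [← H.torsion, map_sub, key, key, Coeffs.brk]

theorem L_bk (H : IsConn bk L) (i j k l : Fin 7) :
    L (bk (e i) (e j)) k l = (coeffs L).brk (fun m => L (e m) k l) i j :=
  H.map_bk ((Matrix.entryLinearMap ℝ ℝ k l) ∘ₗ L) i j

theorem curv_e (H : IsConn bk L) (i j : Fin 7) :
    curv L bk (e i) (e j) = h3 !![(coeffs L).F11 i j, (coeffs L).F12 i j;
      (coeffs L).F21 i j, (coeffs L).F22 i j] ((coeffs L).FV i j)
      ![(coeffs L).FP i j, (coeffs L).FQ i j] := by
  rw [curv, eq_h3_of_mem (H.mem (bk (e i) (e j))), H.apply_e, H.apply_e, Coeffs.mat, Coeffs.mat,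
    h3_comm, h3_sub]
  simp only [H.L_bk]
  congr 1
  · ext k l
    fin_cases k <;> fin_cases l <;>
      simp [Coeffs.F11, Coeffs.F12, Coeffs.F21, Coeffs.F22, coeffs] <;> ring
  · simp [Matrix.trace, Coeffs.FV, coeffs]
  · ext k
    fin_cases k <;> simp [Coeffs.FP, Coeffs.FQ, coeffs]

end IsConn

namespace Coeffs

variable (K : Coeffs)

/-- The trace of the `𝔤𝔩(2)`-component of the curvature. -/
def FT (i j : Fin 7) : ℝ := K.F11 i j + K.F22 i j

/-- The curvature tensor `⟨R(e_i, e_j) e_k, e_l⟩`. -/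
def Rm (i j : Fin 7) : M7 :=
  !![0, 0, 0, 0, K.FT i j, 0, 0;
     0, 0, 0, 0, 0, K.F11 i j, K.F21 i j;
     0, 0, 0, 0, 0, K.F12 i j, K.F22 i j;
     0, 0, 0, 0, √2 * K.FV i j, 0, 0;
     -K.FT i j, 0, 0, -(√2 * K.FV i j), 0, K.FP i j, K.FQ i j;
     0, -K.F11 i j, -K.F12 i j, 0, -K.FP i j, 0, -K.FV i j;
     0, -K.F21 i j, -K.F22 i j, 0, -K.FQ i j, K.FV i j, 0]

/-- All coordinates of `R(e_i, e_j)` vanish. -/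
structure Flat (i j : Fin 7) : Prop where
  f11 : K.F11 i j = 0
  f12 : K.F12 i j = 0
  f21 : K.F21 i j = 0
  f22 : K.F22 i j = 0
  fv : K.FV i j = 0
  fp : K.FP i j = 0
  fq : K.FQ i j = 0

/-- The pairs `i < j` for which `R(e_i, e_j) = 0` by pair symmetry. -/
def flatPairs : List (Fin 7 × Fin 7) :=
  [(0, 1), (0, 2), (1, 2), (0, 3), (1, 3), (2, 3), (1, 4), (2, 4), (0, 5), (0, 6), (3, 5), (3, 6)]

/-- The `v`-coordinates of the curvature. -/
def tabV (r s₁ s₂ : ℝ) : M7 :=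
  !![0, 0, 0, 0, 0, 0, 0;
     0, 0, 0, 0, 0, 0, 0;
     0, 0, 0, 0, 0, 0, 0;
     0, 0, 0, 0, -(√2 * r), 0, 0;
     0, 0, 0, √2 * r, 0, -s₁, -s₂;
     0, 0, 0, 0, s₁, 0, r;
     0, 0, 0, 0, s₂, -r, 0]

/-- The traces of the curvature. -/
def tabT (t₁ t₂ : ℝ) : M7 :=
  !![0, 0, 0, 0, 0, 0, 0;
     0, 0, 0, 0, 0, 0, 0;
     0, 0, 0, 0, 0, 0, 0;
     0, 0, 0, 0, 0, 0, 0;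
     0, 0, 0, 0, 0, t₁, t₂;
     0, 0, 0, 0, -t₁, 0, 0;
     0, 0, 0, 0, -t₂, 0, 0]

/-- The consequences of the Bianchi identities for the coordinates of a connection. -/
structure Facts (K : Coeffs) (r s₁ s₂ t₁ t₂ : ℝ) : Prop where
  flat : ∀ i j, (i, j) ∈ flatPairs → K.Flat i j
  fv : ∀ i j, K.FV i j = tabV r s₁ s₂ i j
  ft : ∀ i j, K.FT i j = tabT t₁ t₂ i j
  f04 : K.F11 0 4 = 0 ∧ K.F12 0 4 = 0 ∧ K.F21 0 4 = 0 ∧ K.F22 0 4 = 0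
  p04 : K.FP 0 4 = t₁
  q04 : K.FQ 0 4 = t₂
  f56 : K.F11 5 6 = 0 ∧ K.F12 5 6 = 0 ∧ K.F21 5 6 = 0 ∧ K.F22 5 6 = 0
  p56 : K.FP 5 6 = s₁
  q56 : K.FQ 5 6 = s₂
  f34 : K.F11 3 4 = 0 ∧ K.F12 3 4 = 0 ∧ K.F21 3 4 = 0 ∧ K.F22 3 4 = 0
  f15 : K.F12 1 5 = K.F11 2 5
  p15 : K.FP 1 5 = K.F11 4 5
  q25 : K.FQ 2 5 = K.F22 4 5
  bv : ∀ i j k,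
    (K.a i + K.d i) * tabV r s₁ s₂ j k - tabT t₁ t₂ j k * K.v i
        - K.brk (fun m => tabV r s₁ s₂ m k) i j +
      ((K.a j + K.d j) * tabV r s₁ s₂ k i - tabT t₁ t₂ k i * K.v j
        - K.brk (fun m => tabV r s₁ s₂ m i) j k) +
      ((K.a k + K.d k) * tabV r s₁ s₂ i j - tabT t₁ t₂ i j * K.v k
        - K.brk (fun m => tabV r s₁ s₂ m j) k i) = 0
  bt : ∀ i j k, K.brk (fun m => tabT t₁ t₂ m k) i j + K.brk (fun m => tabT t₁ t₂ m i) j k +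
    K.brk (fun m => tabT t₁ t₂ m j) k i = 0

end Coeffs

namespace IsConn

variable {bk : V7 → V7 → V7} {L : V7 →ₗ[ℝ] M7}

theorem Rm_eq (H : IsConn bk L) (i j k l : Fin 7) :
    (coeffs L).Rm i j k l = ip ((curv L bk (e i) (e j)).mulVec (e k)) (e l) := by
  rw [H.curv_e, mulVec_e]
  fin_cases k <;> fin_cases l <;> simp [Coeffs.Rm, Coeffs.FT, ip, e, h3, hmat]

theorem Rm_pair (H : IsConn bk L) (i j k l : Fin 7) :
    (coeffs L).Rm i j k l = (coeffs L).Rm k l i j := by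
  rw [H.Rm_eq, H.Rm_eq, H.curv_pair]

theorem Rm_bianchi (H : IsConn bk L) (i j k l : Fin 7) :
    (coeffs L).Rm i j k l + (coeffs L).Rm j k i l + (coeffs L).Rm k i j l = 0 := by
  have h := congrArg (ip · (e l)) (H.bianchi (e i) (e j) (e k))
  simp only [H.Rm_eq]
  simp only [ip, Pi.add_apply, Pi.zero_apply] at h ⊢
  linarith

theorem Rm_swap (H : IsConn bk L) (i j k l : Fin 7) :
    (coeffs L).Rm j i k l = -(coeffs L).Rm i j k l := by
  rw [H.Rm_eq, H.Rm_eq, H.curv_swap (e i), Matrix.neg_mulVec]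
  simp only [ip, Pi.neg_apply]
  ring

theorem sqrt_two_mul_cancel {x : ℝ} (h : √2 * x = 0) : x = 0 := by
  simpa using h

theorem flat (H : IsConn bk L) (i j : Fin 7) (h : ∀ k l, (coeffs L).Rm k l i j = 0) :
    (coeffs L).Flat i j := by
  have h' : ∀ k l, (coeffs L).Rm i j k l = 0 := fun k l => by rw [H.Rm_pair, h]
  exact ⟨h' 1 5, h' 2 5, h' 1 6, h' 2 6, h' 6 5, h' 4 5, h' 4 6⟩

end IsConn

namespace IsConn

variable {bk : V7 → V7 → V7} {L : V7 →ₗ[ℝ] M7}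

/-- The curvature as a linear function of its first argument. -/
def curvLin (H : IsConn bk L) (y : V7) : V7 →ₗ[ℝ] M7 where
  toFun x := curv L bk x y
  map_add' x x' := by
    have hadd : bk (x + x') y = bk x y + bk x' y := by
      simp only [← H.torsion, map_add, Matrix.add_mulVec, Matrix.mulVec_add]
      abel
    simp only [curv, hadd, map_add, add_mul, mul_add]
    abel
  map_smul' s x := by
    have hsmul : bk (s • x) y = s • bk x y := by
      simp only [← H.torsion, map_smul, Matrix.smul_mulVec, Matrix.mulVec_smul, smul_sub]
    simp only [curv, hsmul, map_smul, smul_mul_assoc, mul_smul_comm, smul_sub, RingHom.id_apply]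

theorem curv_entry_bk (H : IsConn bk L) (i j m : Fin 7) (k l : Fin 7) :
    curv L bk (bk (e i) (e j)) (e m) k l =
      (coeffs L).brk (fun n => curv L bk (e n) (e m) k l) i j :=
  H.map_bk ((Matrix.entryLinearMap ℝ ℝ k l) ∘ₗ H.curvLin (e m)) i j

theorem facts (H : IsConn bk L) : (coeffs L).Facts ((coeffs L).FV 5 6) ((coeffs L).FP 5 6)
    ((coeffs L).FQ 5 6) ((coeffs L).FP 0 4) ((coeffs L).FQ 0 4) := by
  have hL := H.apply_e
  have hcv := H.curv_e
  have hce := H.curv_entry_bk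
  have hb₂ := fun i j k => H.bianchi₂ (e i) (e j) (e k)
  have hP : ∀ i j k l, (coeffs L).Rm i j k l = (coeffs L).Rm k l i j := H.Rm_pair
  have hB : ∀ i j k l, (coeffs L).Rm i j k l + (coeffs L).Rm j k i l + (coeffs L).Rm k i j l = 0 :=
    H.Rm_bianchi
  have hS : ∀ i j k l, (coeffs L).Rm j i k l = -(coeffs L).Rm i j k l := H.Rm_swap
  have hflat : ∀ i j, (i, j) ∈ Coeffs.flatPairs → (coeffs L).Flat i j := by
    intro i j hij
    refine H.flat i j fun k l => ?_
    simp only [Coeffs.flatPairs, List.mem_cons, Prod.mk.injEq, List.not_mem_nil, or_false] at hij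
    rcases hij with ⟨rfl, rfl⟩ | ⟨rfl, rfl⟩ | ⟨rfl, rfl⟩ | ⟨rfl, rfl⟩ | ⟨rfl, rfl⟩ | ⟨rfl, rfl⟩ |
      ⟨rfl, rfl⟩ | ⟨rfl, rfl⟩ | ⟨rfl, rfl⟩ | ⟨rfl, rfl⟩ | ⟨rfl, rfl⟩ | ⟨rfl, rfl⟩ <;> rfl
  generalize coeffs L = K at *
  have hv : ∀ i j, K.Rm i j 3 4 = √2 * K.FV i j := fun _ _ => rfl
  have hv' : ∀ i j, K.Rm i j 6 5 = K.FV i j := fun _ _ => rfl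
  have hT : ∀ i j, K.Rm i j 0 4 = K.FT i j := fun _ _ => rfl
  have hv0 : ∀ k l, K.Rm k l 3 4 = 0 → K.FV k l = 0 := by
    intro k l h
    exact sqrt_two_mul_cancel (by rw [← hv, h])
  have h34 : ∀ k l, K.Rm 4 l k 3 = 0 → K.Rm 3 l 4 k = 0 → K.Rm 3 4 k l = 0 := by
    intro k l h h'
    linarith [hB 3 4 k l, hP 4 l k 3, hP 3 l 4 k]
  have h04 : ∀ k l, K.Rm 4 l k 0 = 0 → K.Rm 0 l 4 k = 0 → K.Rm 0 4 k l = 0 := by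
    intro k l h h'
    linarith [hB 0 4 k l, hP 4 l k 0, hP 0 l 4 k]
  have a34 : K.Rm 3 4 1 5 = 0 ∧ K.Rm 3 4 2 5 = 0 ∧ K.Rm 3 4 1 6 = 0 ∧ K.Rm 3 4 2 6 = 0 :=
    ⟨h34 1 5 rfl rfl, h34 2 5 rfl rfl, h34 1 6 rfl rfl, h34 2 6 rfl rfl⟩
  have a04 : K.Rm 0 4 1 5 = 0 ∧ K.Rm 0 4 2 5 = 0 ∧ K.Rm 0 4 1 6 = 0 ∧ K.Rm 0 4 2 6 = 0 :=
    ⟨h04 1 5 rfl rfl, h04 2 5 rfl rfl, h04 1 6 rfl rfl, h04 2 6 rfl rfl⟩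
  have T34 : K.FT 3 4 = 0 := by
    rw [Coeffs.FT, show K.F11 3 4 = 0 from a34.1, show K.F22 3 4 = 0 from a34.2.2.2, add_zero]
  have T04 : K.FT 0 4 = 0 := by
    rw [Coeffs.FT, show K.F11 0 4 = 0 from a04.1, show K.F22 0 4 = 0 from a04.2.2.2, add_zero]
  have v15 := hv0 1 5 (by rw [hP, a34.1])
  have v25 := hv0 2 5 (by rw [hP, a34.2.1])
  have v16 := hv0 1 6 (by rw [hP, a34.2.2.1])
  have v26 := hv0 2 6 (by rw [hP, a34.2.2.2])
  have v04 := hv0 0 4 (by rw [hP, hT, T34])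
  have T15 : K.FT 1 5 = 0 := by rw [← hT, hP, a04.1]
  have T25 : K.FT 2 5 = 0 := by rw [← hT, hP, a04.2.1]
  have T16 : K.FT 1 6 = 0 := by rw [← hT, hP, a04.2.2.1]
  have T26 : K.FT 2 6 = 0 := by rw [← hT, hP, a04.2.2.2]
  have T45 : K.FT 4 5 = K.FP 0 4 := by rw [← hT, hP]; rfl
  have T46 : K.FT 4 6 = K.FQ 0 4 := by rw [← hT, hP]; rfl
  have T56 : K.FT 5 6 = 0 := by
    rw [← hT, hP, ← neg_eq_zero.2 v04]; rfl
  have v45 : K.FV 4 5 = -K.FP 5 6 := by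
    rw [← hv', hP, hS]; rfl
  have v46 : K.FV 4 6 = -K.FQ 5 6 := by
    rw [← hv', hP, hS]; rfl
  have v34 : K.FV 3 4 = -(√2 * K.FV 5 6) := by
    rw [← hv', hP, hS]; rfl
  have vS : ∀ i j, K.FV j i = -K.FV i j := fun i j => by rw [← hv', ← hv', hS]
  have TS : ∀ i j, K.FT j i = -K.FT i j := fun i j => by rw [← hT, ← hT, hS]
  have hFV : ∀ i j, K.FV i j = Coeffs.tabV (K.FV 5 6) (K.FP 5 6) (K.FQ 5 6) i j := by
    have key : ∀ i j, i < j → K.FV i j = Coeffs.tabV (K.FV 5 6) (K.FP 5 6) (K.FQ 5 6) i j := by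
      intro i j hij
      by_cases hf : (i, j) ∈ Coeffs.flatPairs
      · rw [(hflat i j hf).fv]
        simp only [Coeffs.flatPairs, List.mem_cons, Prod.mk.injEq, List.not_mem_nil, or_false] at hf
        rcases hf with ⟨rfl, rfl⟩ | ⟨rfl, rfl⟩ | ⟨rfl, rfl⟩ | ⟨rfl, rfl⟩ | ⟨rfl, rfl⟩ |
          ⟨rfl, rfl⟩ | ⟨rfl, rfl⟩ | ⟨rfl, rfl⟩ | ⟨rfl, rfl⟩ | ⟨rfl, rfl⟩ | ⟨rfl, rfl⟩ |
          ⟨rfl, rfl⟩ <;> rfl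
      · fin_cases i <;> fin_cases j <;> first
          | exact absurd hij (by decide)
          | exact absurd (by decide) hf
          | assumption
          | rfl
    intro i j
    rcases lt_trichotomy i j with h | rfl | h
    · exact key i j h
    · rw [show K.FV i i = 0 by linarith [vS i i]]
      fin_cases i <;> rfl
    · rw [vS, key j i h]
      fin_cases i <;> fin_cases j <;> simp [Coeffs.tabV]
  have hFT : ∀ i j, K.FT i j = Coeffs.tabT (K.FP 0 4) (K.FQ 0 4) i j := by
    have key : ∀ i j, i < j → K.FT i j = Coeffs.tabT (K.FP 0 4) (K.FQ 0 4) i j := by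
      intro i j hij
      by_cases hf : (i, j) ∈ Coeffs.flatPairs
      · rw [Coeffs.FT, (hflat i j hf).f11, (hflat i j hf).f22, add_zero]
        simp only [Coeffs.flatPairs, List.mem_cons, Prod.mk.injEq, List.not_mem_nil, or_false] at hf
        rcases hf with ⟨rfl, rfl⟩ | ⟨rfl, rfl⟩ | ⟨rfl, rfl⟩ | ⟨rfl, rfl⟩ | ⟨rfl, rfl⟩ |
          ⟨rfl, rfl⟩ | ⟨rfl, rfl⟩ | ⟨rfl, rfl⟩ | ⟨rfl, rfl⟩ | ⟨rfl, rfl⟩ | ⟨rfl, rfl⟩ |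
          ⟨rfl, rfl⟩ <;> rfl
      · fin_cases i <;> fin_cases j <;> first
          | exact absurd hij (by decide)
          | exact absurd (by decide) hf
          | assumption
    intro i j
    rcases lt_trichotomy i j with h | rfl | h
    · exact key i j h
    · rw [show K.FT i i = 0 by linarith [TS i i]]
      fin_cases i <;> rfl
    · rw [TS, key j i h]
      fin_cases i <;> fin_cases j <;> simp [Coeffs.tabT]
  have hcV : ∀ i j m, curv L bk (bk (e i) (e j)) (e m) 1 6 =
      K.brk (fun n => Coeffs.tabV (K.FV 5 6) (K.FP 5 6) (K.FQ 5 6) n m) i j := by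
    intro i j m
    simp only [hce, hcv, ← hFV]
    rfl
  have hcT : ∀ i j m, curv L bk (bk (e i) (e j)) (e m) 0 0 =
      K.brk (fun n => Coeffs.tabT (K.FP 0 4) (K.FQ 0 4) n m) i j := by
    intro i j m
    simp only [hce, hcv, ← hFT]
    rfl
  refine ⟨hflat, hFV, hFT, a04, rfl, rfl, ⟨?_, ?_, ?_, ?_⟩, rfl, rfl, a34, ?_, ?_, ?_, ?_, ?_⟩
  · rw [show K.F11 5 6 = K.Rm 5 6 1 5 from rfl, hP, ← neg_eq_zero.2 v15]; rfl
  · rw [show K.F12 5 6 = K.Rm 5 6 2 5 from rfl, hP, ← neg_eq_zero.2 v25]; rfl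
  · rw [show K.F21 5 6 = K.Rm 5 6 1 6 from rfl, hP, ← neg_eq_zero.2 v16]; rfl
  · rw [show K.F22 5 6 = K.Rm 5 6 2 6 from rfl, hP, ← neg_eq_zero.2 v26]; rfl
  · exact hP 1 5 2 5
  · exact hP 1 5 4 5
  · have := hB 4 5 2 6
    rw [hS 2 5 4 6, hP 2 4 5 6, show K.Rm 5 6 2 4 = 0 from rfl] at this
    change K.Rm 2 5 4 6 = K.Rm 4 5 2 6
    linarith
  · intro i j k
    have h := congrFun (congrFun (hb₂ i j k) 1) 6
    simp only [Matrix.add_apply, Matrix.sub_apply _ (curv L bk (bk _ _) _), hcV, hL, hcv,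
      Coeffs.mat, h3_comm] at h
    simp [h3, hmat] at h
    have hft : ∀ i j, K.FT i j = K.F11 i j + K.F22 i j := fun _ _ => rfl
    simp only [← hFV, ← hFT, hft] at h ⊢
    linarith
  · intro i j k
    have h := congrFun (congrFun (hb₂ i j k) 0) 0
    simp only [Matrix.add_apply, Matrix.sub_apply _ (curv L bk (bk _ _) _), hcT, hL, hcv,
      Coeffs.mat, h3_comm] at h
    simp [h3, hmat] at h
    linarith
end IsConn

namespace Coeffs

@[simp] theorem act_zero (K : Coeffs) (f : Fin 7 → ℝ) (i : Fin 7) :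
    K.act f i 0 = (K.a i + K.d i) * f 0 := rfl
@[simp] theorem act_one (K : Coeffs) (f : Fin 7 → ℝ) (i : Fin 7) :
    K.act f i 1 = K.a i * f 1 + K.c i * f 2 := rfl
@[simp] theorem act_two (K : Coeffs) (f : Fin 7 → ℝ) (i : Fin 7) :
    K.act f i 2 = K.b i * f 1 + K.d i * f 2 := rfl
@[simp] theorem act_three (K : Coeffs) (f : Fin 7 → ℝ) (i : Fin 7) :
    K.act f i 3 = √2 * K.v i * f 0 := rfl
@[simp] theorem act_four (K : Coeffs) (f : Fin 7 → ℝ) (i : Fin 7) :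
    K.act f i 4 = K.p i * f 1 + K.q i * f 2 + √2 * K.v i * f 3 - (K.a i + K.d i) * f 4 := rfl
@[simp] theorem act_five (K : Coeffs) (f : Fin 7 → ℝ) (i : Fin 7) :
    K.act f i 5 = -K.p i * f 0 - K.v i * f 2 - K.a i * f 5 - K.b i * f 6 := rfl
@[simp] theorem act_six (K : Coeffs) (f : Fin 7 → ℝ) (i : Fin 7) :
    K.act f i 6 = -K.q i * f 0 + K.v i * f 1 - K.c i * f 5 - K.d i * f 6 := rfl

end Coeffs

theorem eq_zero_of_det_ne_zero {a b c d x y : ℝ} (h : a * d - b * c ≠ 0) (h₁ : a * x + b * y = 0)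
    (h₂ : c * x + d * y = 0) : x = 0 ∧ y = 0 := by
  refine ⟨(mul_eq_zero.1 ?_).resolve_left h, (mul_eq_zero.1 ?_).resolve_left h⟩
  · linear_combination d * h₁ - b * h₂
  · linear_combination a * h₂ - c * h₁

namespace Coeffs

variable {K : Coeffs} {r s₁ s₂ t₁ t₂ : ℝ}

namespace Facts

theorem trace_eq_zero (H : K.Facts r s₁ s₂ t₁ t₂) (hr : r ≠ 0) :
    K.d 0 = -K.a 0 ∧ K.d 1 = -K.a 1 ∧ K.d 2 = -K.a 2 ∧ K.d 3 = -K.a 3 ∧ K.v 0 = 0 := by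
  have h0 := H.bv 0 5 6
  have h1 := H.bv 1 5 6
  have h2 := H.bv 2 5 6
  have h3 := H.bv 3 5 6
  have hv := H.fv 0 3
  simp [FV, tabV, tabT, brk] at h0 h1 h2 h3 hv
  have k : ∀ x y : ℝ, (x + y) * r + x * r + y * r = 0 → y = -x := fun x y h => by
    have : (x + y) * r = 0 := by linear_combination h / 2
    linarith [(mul_eq_zero.1 this).resolve_right hr]
  have k0 := k _ _ h0
  have k3 := k _ _ h3
  refine ⟨k0, k _ _ h1, k _ _ h2, k3, ?_⟩
  rw [k0] at hv
  simpa using hv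

/-- The recurrence equations when `r ≠ 0`, for the directions `x = 0, 1, 2`. -/
theorem mul_t_eq_zero (H : K.Facts r s₁ s₂ t₁ t₂) (hr : r ≠ 0) {x : Fin 7}
    (hx : x = 0 ∨ x = 1 ∨ x = 2) :
    K.a x * t₁ + K.b x * t₂ = 0 ∧ K.c x * t₁ + K.d x * t₂ = 0 ∧
    K.a x * s₁ + K.b x * s₂ = -K.v x * t₁ ∧ K.c x * s₁ + K.d x * s₂ = -K.v x * t₂ := by
  obtain ⟨h0, h1, h2, -⟩ := H.trace_eq_zero hr
  have k1 := H.bt x 4 5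
  have k2 := H.bt x 4 6
  have k3 := H.bv x 4 5
  have k4 := H.bv x 4 6
  rcases hx with rfl | rfl | rfl <;> simp [tabV, tabT, brk, h0, h1, h2] at k1 k2 k3 k4 ⊢ <;>
    refine ⟨?_, ?_, ?_, ?_⟩ <;> linarith

theorem mul_sigma_eq_zero (H : K.Facts r s₁ s₂ t₁ t₂) (hr : r ≠ 0) {x : Fin 7}
    (hx : x = 0 ∨ x = 1 ∨ x = 2) :
    K.a x * (K.a 5 + K.d 5) + K.b x * (K.a 6 + K.d 6) = 0 ∧
    K.c x * (K.a 5 + K.d 5) + K.d x * (K.a 6 + K.d 6) = 0 := by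
  obtain ⟨h0, h1, h2, -⟩ := H.trace_eq_zero hr
  have k1 := H.ft x 5
  have k2 := H.ft x 6
  rcases hx with rfl | rfl | rfl <;>
    simp [FT, F11, F22, tabT, brk, h0, h1, h2] at k1 k2 ⊢ <;>
    refine ⟨?_, ?_⟩ <;> linarith

theorem false_of_det_ne_zero (H : K.Facts r s₁ s₂ t₁ t₂) (hr : r ≠ 0)
    (hdet : K.a 0 * K.d 0 - K.b 0 * K.c 0 ≠ 0) : False := by
  obtain ⟨h0, h1, h2, h3, hv0⟩ := H.trace_eq_zero hr
  have k1 := H.fv 0 1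
  have k2 := H.fv 0 2
  have k5 := H.fv 0 5
  have k6 := H.fv 0 6
  have k := H.fv 5 6
  obtain ⟨hs5, hs6⟩ := H.mul_sigma_eq_zero hr (x := 0) (by simp)
  obtain ⟨hs5, hs6⟩ := eq_zero_of_det_ne_zero hdet hs5 hs6
  simp [FV, tabV, brk, hv0, h0] at k1 k2 k5 k6 k
  obtain ⟨hv1, hv2⟩ := eq_zero_of_det_ne_zero (a := K.a 0) (b := K.c 0) (c := K.b 0) (d := K.d 0)
    (x := K.v 1) (y := K.v 2) (by rwa [mul_comm (K.c 0)]) (by linarith) (by rw [h0]; linarith)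
  simp [hv1, hv2] at k5 k6 k
  obtain ⟨hv5, hv6⟩ := eq_zero_of_det_ne_zero (x := K.v 5) (y := K.v 6) hdet (by linarith)
    (by rw [h0]; linarith)
  simp [hv5, hv6] at k
  exact hr k.symm

end Facts

end Coeffs

namespace Coeffs.Facts

variable {K : Coeffs} {r s₁ s₂ t₁ t₂ : ℝ}

theorem false_of_nilpotent (H : K.Facts r s₁ s₂ t₁ t₂) (hr : r ≠ 0)
    (ha0 : K.a 0 = 0) (hc0 : K.c 0 = 0) (hb0 : K.b 0 ≠ 0) : False := by
  obtain ⟨hd0, hd1, hd2, hd3, hv0⟩ := H.trace_eq_zero hr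
  rw [ha0, neg_zero] at hd0
  have ht2 : t₂ = 0 := by simpa [ha0, hb0] using (H.mul_t_eq_zero hr (x := 0) (by simp)).1
  have hs2 : s₂ = 0 := by simpa [ha0, hb0, hv0] using (H.mul_t_eq_zero hr (x := 0) (by simp)).2.2.1
  have hd6 : K.d 6 = - K.a 6 := by
    have : K.a 6 + K.d 6 = 0 := by
      simpa [ha0, hb0] using (H.mul_sigma_eq_zero hr (x := 0) (by simp)).1
    linarith
  have f01 := H.flat 0 1 (by decide)
  have f02 := H.flat 0 2 (by decide)
  have f12 := H.flat 1 2 (by decide)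
  have hc1 : K.c 1 = 0 := by
    have := f01.f11
    simpa [F11, brk, ha0, hc0, hd0, hb0, hd1] using this
  have ha1 : K.a 1 = 0 := by
    have := f01.f12
    simp [F12, brk, ha0, hc0, hd0, hb0, hd1] at this
    grind
  have hc2 : K.c 2 = 0 := by
    have := f02.f11
    simpa [F11, brk, ha0, hc0, hd0, hb0, hd1, ha1, hc1] using this
  simp only [ha1, neg_zero] at hd1
  have hb1 : K.b 1 = 0 ∧ K.a 2 = 0 := by
    have h1 := f02.f12
    have h2 := f12.f12
    simp [F12, brk, ha0, hc0, hd0, hd1, ha1, hc1, hd2] at h1 h2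
    grind
  obtain ⟨hb1, ha2⟩ := hb1
  simp only [ha2, neg_zero] at hd2
  have hv1 : K.v 1 = 0 := by
    have := f02.fv
    simpa [FV, brk, ha0, hc0, hd0, hd2, ha2, hb0] using this
  have f03 := H.flat 0 3 (by decide)
  have f23 := H.flat 2 3 (by decide)
  have hc3 : K.c 3 = 0 := by
    have := f03.f11
    simpa [F11, brk, ha0, hc0, hd0, hb0, hd3, hv0] using this
  have ha3 : K.a 3 = 0 := by
    have := f03.f12
    simp [F12, brk, ha0, hc0, hd0, hb0, hd3, hv0] at this
    grind
  simp only [ha3, neg_zero] at hd3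
  have hv2 : K.v 2 = 0 := by
    have := f23.f12
    simpa [F12, brk, ha0, hc0, hd0, hb0, hd3, ha3, hc3, ha2, hd2, hc2, hb1] using this
  have f06 := H.flat 0 6 (by decide)
  have f05 := H.flat 0 5 (by decide)
  have hc6 : K.c 6 = 0 := by
    have := f06.f11
    simpa [F11, brk, ha0, hc0, hd0, hb0, hv0, ha1, hd6] using this
  have hq0 : K.q 0 = 2 * K.a 6 := by
    have := f06.f12
    simp [F12, brk, ha0, hc0, hd0, hb0, hv0, hd6, hb1] at this
    grind
  have hc5 : K.c 5 = -K.a 6 := by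
    have := f05.f11
    simp [F11, brk, ha0, hc0, hd0, hb0, hv0, ha2] at this
    grind
  have hv6 : K.v 6 = 0 := by
    have := f05.fv
    simpa [FV, brk, ha0, hc0, hd0, hb0, hv0, ha2, hv2] using this
  have hrv : r = -2 * K.a 6 * K.v 5 := by
    have := H.fv 5 6
    simp [FV, tabV, brk, hv0, hv1, hv2, hv6, hd6, hc5] at this
    linarith
  have e34 := H.fv 3 4
  have e56 := H.ft 5 6
  have g56 := H.f56
  have g04 := H.f04
  have q01 := f01.fq
  have p02 := f02.fp
  have q02 := f02.fq
  have e45 := H.fv 4 5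
  have sb := H.bv 4 5 6
  have x1 := H.f15
  have f24 := H.flat 2 4 (by decide)
  have x2 := f24.f12
  have x3 := f24.fq
  have x4 := f24.fp
  simp [FT, FV, FQ, FP, F11, F12, F21, F22, tabV, tabT, brk, ha0, hc0, hd0, hv0, ha1, hc1, hd1,
    hb1, hv1, ha2, hc2, hd2, hv2, ha3, hc3, hd3, hd6, hc6, hc5, hv6, hs2, ht2, hq0]
    at e34 e56 g56 g04 q01 p02 q02 e45 sb x1 x2 x3 x4
  obtain ⟨g1, -, g3⟩ := g56
  obtain ⟨-, g4, g5⟩ := g04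
  have ha6 : K.a 6 ≠ 0 := by rintro h; simp [h] at hrv; exact hr hrv
  have hv5 : K.v 5 ≠ 0 := by rintro h; simp [h] at hrv; exact hr hrv
  have hc4 : K.c 4 = 0 := g5.resolve_right hb0
  have hq1 : K.q 1 = 0 := q02.resolve_left hb0
  have hd5 : K.d 5 = 0 := by
    have : K.a 6 * K.d 5 = 0 := by linarith
    exact (mul_eq_zero.1 this).resolve_left ha6
  have ha5 : K.a 5 = 0 := by
    have : K.a 6 * K.a 5 = 0 := by rw [hd5] at g1; linarith
    exact (mul_eq_zero.1 this).resolve_left ha6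
  have hd4 : K.b 0 * K.d 4 = K.a 6 * K.b 2 := by linarith
  have hq2 : K.q 2 = 3 * K.d 4 := by
    apply mul_left_cancel₀ hb0
    linarith
  have hdv : K.d 4 = √2 * K.v 3 := by
    have : K.a 6 * K.v 5 * (K.d 4 - √2 * K.v 3) = 0 := by
      simp only [ha5, hd5, hrv] at e45 sb
      grind
    have := (mul_eq_zero.1 this).resolve_left (mul_ne_zero ha6 hv5)
    linarith
  have hd4' : K.d 4 = 0 := by
    by_cases hb2 : K.b 2 = 0
    · rw [hb2, mul_zero] at hd4
      exact (mul_eq_zero.1 hd4).resolve_left hb0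
    · have h4 : K.a 4 + K.d 4 = 0 := by
        apply mul_left_cancel₀ hb2
        rw [hq2] at x2
        linarith
      have : K.d 4 * K.d 4 = 0 := by
        rw [hq1, hc4, hq2, show K.a 4 = -K.d 4 by linarith] at x3
        linarith
      simpa using this
  have hv3 : K.v 3 = 0 := by simpa [hd4'] using hdv.symm
  simp [hv3, hr] at e34

end Coeffs.Facts

namespace Coeffs.Facts

variable {K : Coeffs} {r s₁ s₂ t₁ t₂ : ℝ}

theorem false_of_A₀_eq_zero (H : K.Facts r s₁ s₂ t₁ t₂) (hr : r ≠ 0)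
    (ha0 : K.a 0 = 0) (hb0 : K.b 0 = 0) (hc0 : K.c 0 = 0) (hdc : K.d 1 = K.c 2)
    (hba : K.b 1 ≠ K.a 2) : False := by
  obtain ⟨hd0, hd1, hd2, hd3, hv0⟩ := H.trace_eq_zero hr
  rw [ha0, neg_zero] at hd0
  have hc2 : K.c 2 = -K.a 1 := by rw [← hdc, hd1]
  have hκ : K.b 1 - K.a 2 ≠ 0 := sub_ne_zero.2 hba
  have f12 := H.flat 1 2 (by decide)
  have hv1 : K.v 1 = 0 := by
    have h := f12.fv
    simp [FV, brk, hd1, hc2, hd2] at h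
    have : (K.b 1 - K.a 2) * K.v 1 = 0 := by linarith
    exact (mul_eq_zero.1 this).resolve_left hκ
  have e11 := f12.f11
  have e12 := f12.f12
  have e21 := f12.f21
  simp [F11, F12, F21, brk, hd1, hc2, hd2] at e11 e12 e21
  have hnil : K.a 1 * K.a 1 + K.b 1 * K.c 1 = 0 := by
    have : (K.b 1 - K.a 2) * (K.a 1 * K.a 1 + K.b 1 * K.c 1) = 0 := by grind
    exact (mul_eq_zero.1 this).resolve_left hκ
  have hc1 : K.c 1 = 0 := by
    have : (K.b 1 - K.a 2) * K.c 1 = 0 := by grind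
    exact (mul_eq_zero.1 this).resolve_left hκ
  have ha1 : K.a 1 = 0 := by simpa [hc1] using hnil
  simp only [ha1, neg_zero] at hd1 hc2
  have hb1 : K.b 1 * (K.b 1 + K.a 2) = 0 := by
    simp only [ha1] at e12
    linarith
  have ha2 : K.a 2 ≠ 0 := by
    rintro h
    simp [h] at hb1
    exact hba (by rw [hb1, h])
  have hdet : K.a 2 * K.d 2 - K.b 2 * K.c 2 ≠ 0 := by simp [hd2, hc2, ha2]
  obtain ⟨m1, m2, m3, m4⟩ := H.mul_t_eq_zero hr (x := 2) (by simp)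
  obtain ⟨m5, m6⟩ := H.mul_sigma_eq_zero hr (x := 2) (by simp)
  obtain ⟨ht1, ht2⟩ := eq_zero_of_det_ne_zero hdet m1 m2
  rw [ht1, mul_zero] at m3
  rw [ht2, mul_zero] at m4
  obtain ⟨hs1, hs2⟩ := eq_zero_of_det_ne_zero hdet m3 m4
  obtain ⟨h5, h6⟩ := eq_zero_of_det_ne_zero hdet m5 m6
  by_cases hv2 : K.v 2 = 0
  · have e25 := H.fv 2 5
    have e26 := H.fv 2 6
    have e56 := H.fv 5 6
    simp [FV, tabV, brk, hv0, hv1, hv2, hc2, hd2, h5, h6] at e25 e26 e56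
    have hv6 : K.v 6 = 0 := e26.resolve_left ha2
    have hv5 : K.v 5 = 0 := by simpa [hv6, ha2] using e25
    simp [hv5, hv6] at e56
    exact hr e56.symm
  · have hd3' : K.d 3 = 0 := by
      have := H.fv 2 3
      simpa [FV, tabV, brk, hv0, hv1, hv2, hd2, hd3] using this
    have hc3 : K.c 3 = 0 := by
      have := H.fv 1 3
      simpa [FV, tabV, brk, hv0, hv1, hv2, hd1, ha1, hd3] using this
    have ha3 : K.a 3 = 0 := by linarith
    have f23 := H.flat 2 3 (by decide)
    have hb3 : K.b 3 = 0 := by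
      have := f23.f12
      simp [F12, brk, hb0, ha3, hd3', hd2] at this
      grind
    have hv3 : K.v 3 = 0 := by
      have := (H.flat 3 5 (by decide)).f11
      simpa [F11, brk, ha0, ha1, ha2, hb3, hc3, ha3, hd3'] using this
    have f02 := H.flat 0 2 (by decide)
    have hq0 : K.q 0 = 0 := by
      have := f02.fq
      simp [FQ, brk, ha0, hb0, hc0, hd0, hd2, hc2, ha2] at this
      exact this.resolve_left fun h => ha2 (by linarith)
    have hp0 : K.p 0 = 0 := by
      have := f02.fp
      simp [FP, brk, ha0, hb0, hc0, hd0, hd2, hc2, ha2, hq0] at this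
      exact this.resolve_left fun h => ha2 (by linarith)
    have hq3 : K.q 3 = 0 := by
      have := f23.fq
      simp [FQ, brk, hc3, ha3, hb3, hd3', hd2, hc2, ha2, hq0] at this
      exact this.resolve_left fun h => ha2 (by linarith)
    have e34 := H.fv 3 4
    simp [FV, tabV, brk, ha3, hd3', hv3, hv0, hv1, hq3] at e34
    exact hr e34

end Coeffs.Facts

namespace Coeffs

variable {K : Coeffs}

/-- The trace of `Λ(e_i)` in `𝔤𝔩(2)`. -/
def tr (K : Coeffs) (i : Fin 7) : ℝ := K.a i + K.d i

theorem act_sub_mul (f g : Fin 7 → ℝ) (k : ℝ) (i j : Fin 7) :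
    K.act (fun n => f n - k * g n) i j = K.act f i j - k * K.act g i j := by
  fin_cases j <;> simp <;> ring

theorem brk_sub_mul (f g : Fin 7 → ℝ) (k : ℝ) (i j : Fin 7) :
    K.brk (fun n => f n - k * g n) i j = K.brk f i j - k * K.brk g i j := by
  simp only [brk, act_sub_mul]
  ring

theorem FT_eq (i j : Fin 7) : K.FT i j = -K.brk K.tr i j := by
  have h : K.brk K.tr i j = K.brk K.a i j - (-1) * K.brk K.d i j := by
    rw [← brk_sub_mul]
    congr 1
    ext n
    rw [tr]
    ring
  rw [h, FT, F11, F22]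
  ring

namespace Facts

variable {r s₁ s₂ t₁ t₂ : ℝ}

theorem shifted (H : K.Facts r s₁ s₂ t₁ t₂) (k : ℝ) (i j : Fin 7) :
    K.tr i * (K.v j - k * K.tr j) - K.tr j * (K.v i - k * K.tr i) -
      K.brk (fun n => K.v n - k * K.tr n) i j = tabV r s₁ s₂ i j - k * tabT t₁ t₂ i j := by
  rw [← H.fv, ← H.ft, FT_eq, brk_sub_mul, FV, ← tr, ← tr]
  ring

theorem v_zero_of_tr_zero (H : K.Facts r s₁ s₂ t₁ t₂) (h0 : K.tr 0 = 0) : K.v 0 = 0 := by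
  have h := H.fv 0 3
  rw [tr] at h0
  simp [FV, tabV, brk, h0] at h
  have : √2 * (K.v 0 * K.v 0) = 0 := by linarith
  simpa using this

theorem recurrence_s (H : K.Facts 0 s₁ 0 0 0) (hs : s₁ ≠ 0) {x : Fin 7}
    (hx : x = 0 ∨ x = 1 ∨ x = 2) :
    K.a x = -2 * K.tr x ∧ K.c x = 0 ∧ K.d x = 3 * K.tr x := by
  have r5 := H.bv x 4 5
  have r6 := H.bv x 4 6
  have ha : K.a x = -2 * K.tr x := by
    apply mul_right_cancel₀ hs
    rcases hx with rfl | rfl | rfl <;> simp [tabV, tabT, brk, hs] at r5 <;> rw [tr] <;> linarith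
  refine ⟨ha, ?_, ?_⟩
  · rcases hx with rfl | rfl | rfl <;> simpa [tabV, tabT, brk, hs] using r6
  · rw [tr] at ha ⊢
    linarith

theorem eq_zero_of_shifted (H : K.Facts 0 s₁ 0 0 0) (hs : s₁ ≠ 0) (u : Fin 7 → ℝ)
    (hu : ∀ i j, K.tr i * u j - K.tr j * u i - K.brk u i j = tabV 0 s₁ 0 i j)
    (h : K.tr 0 ≠ 0 ∧ u 0 = 0 ∨ K.tr 1 ≠ 0 ∧ u 0 = 0 ∧ u 1 = 0 ∨
      K.tr 2 ≠ 0 ∧ K.tr 0 = 0 ∧ K.tr 1 = 0 ∧ u 0 = 0 ∧ u 2 = 0) : u = 0 := by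
  have htr : ∀ n, K.a n + K.d n = K.tr n := fun _ => rfl
  obtain ⟨a0, c0, d0⟩ := H.recurrence_s hs (x := 0) (by simp)
  obtain ⟨a1, c1, d1⟩ := H.recurrence_s hs (x := 1) (by simp)
  obtain ⟨a2, c2, d2⟩ := H.recurrence_s hs (x := 2) (by simp)
  rcases h with ⟨h0, u0⟩ | ⟨h1, u0, u1⟩ | ⟨h2, h0, h1, u0, u2⟩
  · have hz : ∀ y, K.tr 0 * y = 0 → y = 0 := fun y h => (mul_eq_zero.1 h).resolve_left h0
    have u1 : u 1 = 0 := by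
      have := hu 0 1
      simp [brk, tabV, htr, u0, a0, c0] at this
      exact hz _ (by linarith)
    have u2 : u 2 = 0 := by
      have := hu 0 2
      simp [brk, tabV, htr, u0, u1, d0] at this
      exact hz _ (by linarith)
    have u3 : u 3 = 0 := by
      have := hu 0 3
      simpa [brk, tabV, htr, u0, h0] using this
    have u4 : u 4 = 0 := by
      have := hu 0 4
      simpa [brk, tabV, htr, u0, u1, u2, u3, h0] using this
    have u6 : u 6 = 0 := by
      have := hu 0 6
      simp [brk, tabV, htr, u0, u1, c0, d0] at this
      exact hz _ (by linarith)
    have u5 : u 5 = 0 := by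
      have := hu 0 5
      simp [brk, tabV, htr, u0, u2, u6, a0] at this
      exact hz _ (by linarith)
    ext n
    fin_cases n <;> assumption
  · have hz : ∀ y, K.tr 1 * y = 0 → y = 0 := fun y h => (mul_eq_zero.1 h).resolve_left h1
    have u2 : u 2 = 0 := by
      have := hu 1 2
      simp [brk, tabV, htr, u1, d1, c2] at this
      exact hz _ (by linarith)
    have u3 : u 3 = 0 := by
      have := hu 1 3
      simpa [brk, tabV, htr, u0, u1, u2, h1] using this
    have u4 : u 4 = 0 := by
      have := hu 1 4
      simpa [brk, tabV, htr, u1, u2, u3, h1] using this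
    have u6 : u 6 = 0 := by
      have := hu 1 6
      simp [brk, tabV, htr, u0, u1, u2, c1, d1] at this
      exact hz _ (by linarith)
    have u5 : u 5 = 0 := by
      have := hu 1 5
      simp [brk, tabV, htr, u0, u1, u2, u6, a1] at this
      exact hz _ (by linarith)
    ext n
    fin_cases n <;> assumption
  · have hz : ∀ y, K.tr 2 * y = 0 → y = 0 := fun y h => (mul_eq_zero.1 h).resolve_left h2
    rw [h1, mul_zero] at a1 d1
    have u1 : u 1 = 0 := by
      have e1 := hu 1 2
      have e2 := (H.flat 1 2 (by decide)).f12
      simp [brk, F12, tabV, u2, a1, d1, c1, a2, c2, d2, h1] at e1 e2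
      grind
    have u3 : u 3 = 0 := by
      have := hu 2 3
      simpa [brk, tabV, htr, u0, u1, u2, h2] using this
    have u4 : u 4 = 0 := by
      have := hu 2 4
      simpa [brk, tabV, htr, u1, u2, u3, h2] using this
    have u6 : u 6 = 0 := by
      have := hu 2 6
      simp [brk, tabV, htr, u0, u1, u2, c2, d2] at this
      exact hz _ (by linarith)
    have u5 : u 5 = 0 := by
      have := hu 2 5
      simp [brk, tabV, htr, u0, u1, u2, u6, a2] at this
      exact hz _ (by linarith)
    ext n
    fin_cases n <;> assumption

theorem v_eq_mul_tr_of_t_eq_zero (H : K.Facts 0 s₁ 0 0 0) (hs : s₁ ≠ 0)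
    (h : ¬(K.tr 0 = 0 ∧ K.tr 1 = 0 ∧ K.tr 2 = 0)) : ∃ k, ∀ i, K.v i = k * K.tr i := by
  have key : ∀ k, (let u : Fin 7 → ℝ := fun n => K.v n - k * K.tr n
      K.tr 0 ≠ 0 ∧ u 0 = 0 ∨ K.tr 1 ≠ 0 ∧ u 0 = 0 ∧ u 1 = 0 ∨
      K.tr 2 ≠ 0 ∧ K.tr 0 = 0 ∧ K.tr 1 = 0 ∧ u 0 = 0 ∧ u 2 = 0) →
      ∃ k, ∀ i, K.v i = k * K.tr i := by
    intro k hk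
    have h0 := H.eq_zero_of_shifted hs (fun n => K.v n - k * K.tr n) (fun i j => by
      rw [H.shifted k i j]
      fin_cases i <;> fin_cases j <;> simp [tabT]) hk
    exact ⟨k, fun i => sub_eq_zero.1 (congrFun h0 i)⟩
  have hdiv : ∀ x y : ℝ, y ≠ 0 → x - x / y * y = 0 := fun x y h => by
    rw [div_mul_cancel₀ _ h, sub_self]
  by_cases h0 : K.tr 0 = 0
  · have hv0 := H.v_zero_of_tr_zero h0
    by_cases h1 : K.tr 1 = 0
    · have h2 : K.tr 2 ≠ 0 := by tauto
      exact key (K.v 2 / K.tr 2) (.inr (.inr ⟨h2, h0, h1, by simp [hv0, h0], hdiv _ _ h2⟩))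
    · exact key (K.v 1 / K.tr 1) (.inr (.inl ⟨h1, by simp [hv0, h0], hdiv _ _ h1⟩))
  · exact key (K.v 0 / K.tr 0) (.inl ⟨h0, hdiv _ _ h0⟩)

end Facts
end Coeffs

namespace Coeffs.Facts

variable {K : Coeffs} {s₁ t₁ : ℝ}

theorem false_of_trace_eq_zero (H : K.Facts 0 s₁ 0 t₁ 0) (hst : ¬(s₁ = 0 ∧ t₁ = 0))
    (ha0 : K.a 0 = 0) (hc0 : K.c 0 = 0) (hd0 : K.d 0 = 0)
    (ha1 : K.a 1 = 0) (hd1 : K.d 1 = 0)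
    (ha2 : K.a 2 = 0) (hc2 : K.c 2 = 0) (hd2 : K.d 2 = 0)
    (hb1 : K.b 1 = 0) (hb0 : K.b 0 ≠ 0) : False := by
  have hv0 : K.v 0 = 0 := H.v_zero_of_tr_zero (by rw [tr, ha0, hd0, add_zero])
  have hv1 : K.v 1 = 0 := by
    have := H.fv 0 2
    simpa [FV, tabV, brk, ha0, hc0, hd0, ha2, hc2, hd2, hb0, hv0] using this
  have ht6 : K.d 6 = -K.a 6 := by
    have := H.ft 0 5
    simp [FT, F11, F22, tabT, brk, ha0, hc0, hd0, ha1, hd1, ha2, hd2, hv0] at this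
    grind
  have hv6 : K.v 6 = 0 := by
    have := H.fv 0 5
    simpa [FV, tabV, brk, ha0, hc0, hd0, hb0, hv0, hv1] using this
  have f03 := H.flat 0 3 (by decide)
  have f06 := H.flat 0 6 (by decide)
  have hc3 : K.c 3 = 0 := by
    have := f03.f11
    simpa [F11, brk, ha0, hc0, hd0, hb0, hv0] using this
  have hd3 : K.d 3 = 0 := by
    have := f03.f12
    simp [F12, brk, ha0, hc0, hd0, hb0, hv0] at this
    grind
  have hc6 : K.c 6 = 0 := by
    have := f06.f11
    simpa [F11, brk, ha0, hc0, hd0, hb0, hv0, ha1, ht6] using this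
  have hq0 : K.q 0 = 2 * K.a 6 := by
    have := f06.f12
    simp [F12, brk, ha0, hc0, hd0, hb0, hv0, ht6, hb1] at this
    grind
  have hc5 : K.c 5 = -K.a 6 := by
    have := (H.flat 0 5 (by decide)).f11
    simp [F11, brk, ha0, hc0, hd0, hb0, hv0, ha2] at this
    grind
  have i1 := H.bv 3 4 5
  have i2 := H.bt 3 4 5
  have i3 := H.bv 4 5 6
  have i4 := H.bt 4 5 6
  simp [tabV, tabT, brk, ha0, hc0, hd0, ha1, hd1, ha2, hc2, hd2, hb1, hv0,
    hv1, hv6, ht6, hc6, hq0, hc5, hd3, hc3] at i1 i2 i3 i4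
  have ha3 : K.a 3 = 0 := by grind
  have hg : K.a 6 = 0 := by grind
  rw [hg] at hc5 hq0 ht6
  have hv2 : K.v 2 = 0 := by
    have := (H.flat 2 3 (by decide)).f12
    simpa [F12, brk, ha0, hc0, hd0, hb0, hd3, ha3, hc3, ha2, hd2, hc2, hb1] using this
  obtain ⟨hc4, hd4, -⟩ := H.f04
  simp [F11, F12, brk, ha0, hc0, hd0, ha1, hd1, ha2, hc2, hb1, hv0, hb0] at hd4 hc4
  have hd4 : K.d 4 = 0 := by grind
  have ht : t₁ = 0 := by
    have := H.ft 4 5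
    simp [FT, F11, F22, tabT, brk, ha0, ha1, ha2, ha3, hc4, hc5, hd0, hd1, hd2, hd3, hd4, hg,
      ht6] at this
    linarith
  have hs : s₁ ≠ 0 := fun h => hst ⟨h, ht⟩
  have hq1 : K.q 1 = 0 := by
    have := (H.flat 0 2 (by decide)).fq
    simpa [FQ, brk, ha0, hc0, hd0, ha2, hc2, hd2, hq0, hb0] using this
  have hp1 : K.p 1 = 0 := by
    have := H.f15
    simpa [F11, F12, brk, ha0, hc0, hd0, ha1, hd1, ha2, hc2, hd2, hb1, hc5, ht6, hg, hq1,
      hv0, hv1, hv2, hb0] using this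
  have hq3 : K.q 3 = 0 := by
    have := (H.flat 0 3 (by decide)).fp
    simpa [FP, brk, ha0, hc0, hd0, ha3, hd3, hc3, hq0, hv0, hb0] using this
  have hq6 : K.q 6 = 0 := by
    have := (H.flat 0 6 (by decide)).fp
    simpa [FP, brk, ha0, hc0, hd0, hc6, ht6, hg, hq0, hv0, hv6, hb0, hp1] using this
  have f05 := H.flat 0 5 (by decide)
  have hb6 : K.b 6 = -K.p 0 - 2 * K.d 5 := by
    have := f05.f12
    simp [F12, brk, ha0, hc0, hd0, hb1, hq0, hv0] at this
    apply mul_left_cancel₀ hb0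
    linarith
  have hqp : K.b 0 * (K.q 5 + K.p 6) = K.p 0 * (K.a 5 - K.p 0) := by
    have := f05.fp
    simp [FP, brk, ha0, hc0, hd0, hp1, hq0, hv0] at this
    linarith
  have hpq : K.b 0 * (K.p 6 - K.q 5) = K.b 6 * (K.a 5 - K.b 6) := by
    have := H.f56.2.1
    simp [F12, brk, hc5, hc6, hg, ht6, hv6, hb1, hq6] at this
    linarith
  have had : K.a 4 = 0 ∨ K.d 5 = 0 := by
    have := H.p15
    simp [FP, F11, brk, ha0, ha1, hd1, hb1, hc4, hc5, hp1, hq1, hg, hv1, ha2, ha3] at this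
    rw [← mul_eq_zero]
    linarith
  have hv3 : K.a 5 + K.d 5 = 0 ∨ K.v 3 = 0 := by
    have := H.fv 3 5
    simpa [FV, tabV, brk, hv0, hv1, hv2, hv6, ha3, hd3, hc3] using this
  have hv4 : K.b 3 * K.a 4 + √2 * K.v 3 * K.b 3 = √2 * K.v 4 * K.b 0 := by
    have := H.f34.2.1
    simp [F12, brk, ha3, hc3, hd3, hb1, hd4, hq3] at this
    linarith
  have hs₁ : 2 * (K.a 4 * K.v 5) + √2 * K.v 5 * K.v 3 - 2 * (K.a 5 + K.d 5) * K.v 4 = -s₁ := by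
    have := H.fv 4 5
    simp [FV, tabV, brk, hv0, hv1, hv2, hv6, hd4, hc4] at this
    linarith
  have hs₁' : K.b 0 * (2 * (K.a 5 + K.d 5) * K.p 6 + 2 * (K.p 0 + K.d 5) * K.q 5 +
      2 * K.d 5 * K.p 6) = K.b 0 * s₁ := by
    have := H.p56
    simp [FP, brk, hg, ht6, hc5, hc6, hq6, hp1, hv6, hq0, hb6] at this
    rw [← this]
    ring
  rw [hb6] at hpq
  apply mul_ne_zero hb0 hs
  rw [← hs₁']
  by_cases hτ : K.a 5 + K.d 5 = 0
  · have : K.d 5 = -K.a 5 := by linarith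
    rw [this] at hpq ⊢
    linear_combination (K.p 0 - 2 * K.a 5) * hqp - K.p 0 * hpq
  · rcases had with h | h
    · have h3 := hv3.resolve_left hτ
      have h4 : K.v 4 = 0 := by simpa [h, h3, hb0] using hv4
      simp [h, h3, h4] at hs₁
      exact absurd hs₁ hs
    · rw [h] at hpq ⊢
      linear_combination (K.a 5 + K.p 0) * hqp + (K.a 5 - K.p 0) * hpq

end Coeffs.Facts

namespace Coeffs.Facts

variable {K : Coeffs} {s₁ s₂ t₁ : ℝ}

theorem recurrence_t (H : K.Facts 0 s₁ s₂ t₁ 0) (ht : t₁ ≠ 0) {x : Fin 7}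
    (hx : x = 0 ∨ x = 1 ∨ x = 2 ∨ x = 3) :
    K.a x = -K.tr x ∧ K.c x = 0 ∧ K.d x = 2 * K.tr x := by
  have r5 := H.bt x 4 5
  have r6 := H.bt x 4 6
  have ha : K.a x = -K.tr x := by
    apply mul_right_cancel₀ ht
    rcases hx with rfl | rfl | rfl | rfl <;> simp [tabT, brk, ht] at r5 <;> rw [tr] <;> grind
  refine ⟨ha, ?_, ?_⟩
  · rcases hx with rfl | rfl | rfl | rfl <;> simpa [tabT, brk, ht] using r6
  · rw [tr] at ha ⊢
    linarith

theorem recurrence_s_of_t (H : K.Facts 0 s₁ s₂ t₁ 0) (ht : t₁ ≠ 0) {x : Fin 7}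
    (hx : x = 0 ∨ x = 1 ∨ x = 2) :
    K.tr x * s₂ = 0 ∧ t₁ * K.v x = -(K.tr x * s₁) - K.b x * s₂ := by
  obtain ⟨ha, hc, hd⟩ := H.recurrence_t ht (x := x) (by tauto)
  have r5 := H.bv x 4 5
  have r6 := H.bv x 4 6
  rcases hx with rfl | rfl | rfl <;> simp [tabV, tabT, brk, ha, hc, hd] at r5 r6 ⊢ <;>
    constructor <;> grind

theorem false_of_p_q_eq_zero (H : K.Facts 0 s₁ s₂ t₁ 0) (ht : t₁ ≠ 0) (h0 : K.tr 0 = 0)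
    (hb0 : K.b 0 = 0) (hp0 : K.p 0 = 0) (hq0 : K.q 0 = 0) : False := by
  have := H.p04
  rw [FP] at this
  obtain ⟨ha, hc, hd⟩ := H.recurrence_t ht (x := 0) (by tauto)
  rw [h0] at ha hd
  have hv := H.v_zero_of_tr_zero h0
  simp [brk, ha, hc, hd, hb0, hp0, hq0, hv] at this
  exact ht this.symm

theorem tr_one_eq_zero (H : K.Facts 0 s₁ s₂ t₁ 0) (ht : t₁ ≠ 0) (h0 : K.tr 0 = 0) :
    K.tr 1 = 0 := by
  by_contra h1
  obtain ⟨a0, c0, d0⟩ := H.recurrence_t ht (x := 0) (by tauto)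
  obtain ⟨a1, c1, d1⟩ := H.recurrence_t ht (x := 1) (by tauto)
  rw [h0] at a0 d0
  have f := H.flat 0 1 (by decide)
  have hb0 : K.b 0 = 0 := by
    have := f.f12
    simp [F12, brk, a0, c0, d0, a1, c1, d1] at this
    grind
  have hq0 : K.q 0 = 0 := by
    have := f.fq
    simp [FQ, brk, a0, c0, d0, a1, c1, d1, hb0] at this
    grind
  have hp0 : K.p 0 = 0 := by
    have := f.fp
    simp [FP, brk, a0, c0, d0, a1, c1, d1, hb0, hq0] at this
    grind
  exact H.false_of_p_q_eq_zero ht h0 hb0 hp0 hq0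

theorem tr_two_eq_zero (H : K.Facts 0 s₁ s₂ t₁ 0) (ht : t₁ ≠ 0) (h0 : K.tr 0 = 0) :
    K.tr 2 = 0 := by
  by_contra h2
  obtain ⟨a0, c0, d0⟩ := H.recurrence_t ht (x := 0) (by tauto)
  obtain ⟨a1, c1, d1⟩ := H.recurrence_t ht (x := 1) (by tauto)
  obtain ⟨a2, c2, d2⟩ := H.recurrence_t ht (x := 2) (by tauto)
  rw [h0] at a0 d0
  rw [H.tr_one_eq_zero ht h0] at a1 d1
  have f := H.flat 0 2 (by decide)
  have hb0 : K.b 0 = 0 := by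
    have h := f.f12
    have h' := (H.flat 1 2 (by decide)).f12
    simp [F12, brk, a0, c0, d0, a1, c1, d1, a2, c2, d2] at h h'
    grind
  have hq0 : K.q 0 = 0 := by
    have := f.fq
    simp [FQ, brk, a0, c0, d0, a2, c2, d2, hb0] at this
    grind
  have hp0 : K.p 0 = 0 := by
    have := f.fp
    simp [FP, brk, a0, c0, d0, a2, c2, d2, hb0, hq0] at this
    grind
  exact H.false_of_p_q_eq_zero ht h0 hb0 hp0 hq0

end Coeffs.Facts

namespace Coeffs.Facts

variable {K : Coeffs} {s₁ s₂ t₁ : ℝ}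

theorem FQ_shifted (ha : ∀ n, K.a n = -K.tr n) (hc : ∀ n, K.c n = 0)
    (hd : ∀ n, K.d n = 2 * K.tr n) (m : ℝ) (i j : Fin 7) :
    3 * K.tr i * (K.q j - m * K.tr j) - 3 * K.tr j * (K.q i - m * K.tr i) -
      K.brk (fun n => K.q n - m * K.tr n) i j = K.FQ i j - m * K.FT i j := by
  rw [brk_sub_mul, FQ, FT_eq, ha, ha, hc, hc, hd, hd]
  ring

/-- If `v` differs from a multiple of the trace only at `e_5`, then `Λ` has `𝔤𝔩(2)`-part
`τ • diag(-1, 2)` up to strictly upper triangular matrices, contradicting the pair symmetry. -/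
theorem false_of_shifted (H : K.Facts 0 s₁ s₂ t₁ 0) (ht : t₁ ≠ 0) (h0 : K.tr 0 ≠ 0)
    (h2 : K.tr 2 = 0) {u : Fin 7 → ℝ} (hu : ∀ i, i ≠ 5 → u i = 0) (hu5 : u 5 ≠ 0)
    (hs : ∀ i j, K.tr i * u j - K.tr j * u i - K.brk u i j = 0) : False := by
  have htr : ∀ n, K.a n + K.d n = K.tr n := fun _ => rfl
  have hz : ∀ y, K.tr 0 * y = 0 → y = 0 := fun y h => (mul_eq_zero.1 h).resolve_left h0
  have u0 := hu 0 (by decide)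
  have u1 := hu 1 (by decide)
  have u2 := hu 2 (by decide)
  have u3 := hu 3 (by decide)
  have u4 := hu 4 (by decide)
  have u6 := hu 6 (by decide)
  obtain ⟨a0, c0, d0⟩ := H.recurrence_t ht (x := 0) (by tauto)
  obtain ⟨a1, c1, d1⟩ := H.recurrence_t ht (x := 1) (by tauto)
  obtain ⟨a2, c2, d2⟩ := H.recurrence_t ht (x := 2) (by tauto)
  obtain ⟨a3, c3, d3⟩ := H.recurrence_t ht (x := 3) (by tauto)
  have a4 : K.a 4 = -K.tr 4 := by
    have := hs 4 5
    simp [brk, u1, u2, u3, u4, u0, u6] at this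
    grind
  have c4 : K.c 4 = 0 := by
    have := hs 4 6
    simpa [brk, u1, u2, u3, u4, u0, u6, hu5] using this
  have c5 : K.c 5 = K.tr 6 + K.a 6 := by
    have := hs 5 6
    simp [brk, u1, u2, u3, u4, u0, u6] at this
    grind
  have d4 : K.d 4 = 2 * K.tr 4 := by linarith [htr 4]
  have k5 : K.p 0 * K.tr 0 + K.b 0 * K.tr 6 = 0 := by
    have := H.ft 0 5
    simp [FT_eq, tabT, brk, a0, h2, htr] at this
    linarith
  have f05 := H.flat 0 5 (by decide)
  have f06 := H.flat 0 6 (by decide)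
  have c6 : K.c 6 = 0 := by
    have := f06.f21
    simp [F21, brk, a0, c0, c1, c2, d0] at this
    grind
  have e5 : K.c 5 = 0 := by
    have := f05.f21
    simp [F21, brk, a0, c0, c1, c2, d0, c6] at this
    grind
  have a6 : K.a 6 = -K.tr 6 := by linarith
  have a5 : K.a 5 = -K.tr 5 := by
    have := f05.f11
    simp [F11, brk, a0, c0, a1, a2, h2, d0, a6, e5] at this
    grind
  have d5 : K.d 5 = 2 * K.tr 5 := by linarith [htr 5]
  have d6 : K.d 6 = 2 * K.tr 6 := by linarith [htr 6]
  have ha : ∀ n, K.a n = -K.tr n := by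
    intro n
    fin_cases n <;> assumption
  have hc : ∀ n, K.c n = 0 := by
    intro n
    fin_cases n <;> assumption
  have hd : ∀ n, K.d n = 2 * K.tr n := by
    intro n
    fin_cases n <;> assumption
  obtain ⟨m, hm⟩ : ∃ m, K.q 0 - m * K.tr 0 = 0 := ⟨K.q 0 / K.tr 0, by field_simp; simp⟩
  have hq : ∀ j, K.FQ 0 j = 0 → K.FT 0 j = 0 →
      3 * K.tr 0 * (K.q j - m * K.tr j) - K.brk (fun n => K.q n - m * K.tr n) 0 j = 0 := by
    intro j hj hj'
    have := FQ_shifted ha hc hd m 0 j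
    rw [hj, hj', hm] at this
    linarith
  have h25 := FQ_shifted ha hc hd m 2 5
  set ψ : Fin 7 → ℝ := fun n => K.q n - m * K.tr n with hψ
  change ∀ j, _ → _ → 3 * K.tr 0 * ψ j - K.brk ψ 0 j = 0 at hq
  change ψ 0 = 0 at hm
  have ψ1 : ψ 1 = 0 := by
    have := hq 1 (H.flat 0 1 (by decide)).fq (H.ft 0 1)
    simp [brk, hm, a0, c0] at this
    exact hz _ (by linarith)
  have ψ2 : ψ 2 = 0 := by
    have := hq 2 (H.flat 0 2 (by decide)).fq (H.ft 0 2)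
    simp [brk, hm, d0, ψ1] at this
    exact hz _ (by linarith)
  have ψ3 : ψ 3 = 0 := by
    have := hq 3 (H.flat 0 3 (by decide)).fq (H.ft 0 3)
    simpa [brk, hm, h0] using this
  have ψ6 : ψ 6 = 0 := by
    have := hq 6 (H.flat 0 6 (by decide)).fq (H.ft 0 6)
    simp [brk, hm, c0, d0, ψ1] at this
    exact hz _ (by linarith)
  have ψ5 : ψ 5 = 0 := by
    have := hq 5 (H.flat 0 5 (by decide)).fq (H.ft 0 5)
    simp [brk, hm, a0, ψ2, ψ6] at this
    exact hz _ (by linarith)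
  have hF : K.F22 4 5 = 2 * K.FT 4 5 := by
    have : K.d = fun n => 0 - -2 * K.tr n := by
      ext n
      rw [hd]
      ring
    rw [F22, hc, hc, this, brk_sub_mul (fun _ => 0), FT_eq]
    simp [brk]
    ring
  rw [H.q25, hF, H.ft, H.ft] at h25
  change 3 * K.tr 2 * ψ 5 - 3 * K.tr 5 * ψ 2 - K.brk ψ 2 5 = _ at h25
  simp [tabT, brk, hm, ψ1, ψ2, ψ5, ψ6, ht] at h25

theorem v_eq_mul_tr (H : K.Facts 0 s₁ s₂ t₁ 0) (ht : t₁ ≠ 0) (h0 : K.tr 0 ≠ 0) :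
    ∃ k, ∀ i, K.v i = k * K.tr i := by
  have htr : ∀ n, K.a n + K.d n = K.tr n := fun _ => rfl
  have hz : ∀ y, K.tr 0 * y = 0 → y = 0 := fun y h => (mul_eq_zero.1 h).resolve_left h0
  obtain ⟨a0, c0, d0⟩ := H.recurrence_t ht (x := 0) (by tauto)
  obtain ⟨a3, c3, d3⟩ := H.recurrence_t ht (x := 3) (by tauto)
  obtain ⟨hs2, hv0⟩ := H.recurrence_s_of_t ht (x := 0) (by tauto)
  have hs2 := hz _ hs2
  subst hs2
  have hv1 : K.v 1 = 0 := by
    have := H.fv 0 1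
    simp [FV, tabV, brk, a0, c0, d0] at this
    exact hz _ (by linarith)
  have h1 : K.tr 1 = 0 := by
    have := H.ft 0 1
    simp [FT_eq, tabT, brk, htr, a0, c0] at this
    exact hz _ (by linarith)
  have hv2 : K.v 2 = 0 := by
    have := H.fv 0 2
    simp [FV, tabV, brk, a0, d0, hv1] at this
    exact hz _ (by linarith)
  have h2 : K.tr 2 = 0 := by
    have := H.ft 0 2
    simp [FT_eq, tabT, brk, htr, d0, h1] at this
    exact hz _ (by linarith)
  have hv3 : t₁ * K.v 3 = -(K.tr 3 * s₁) := by
    have := H.bv 3 4 5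
    simp [tabV, tabT, brk, a3, d3, c3] at this
    linarith
  by_contra! hk
  obtain ⟨n, hn⟩ := hk (-s₁ / t₁)
  have hst : -s₁ / t₁ * t₁ = -s₁ := div_mul_cancel₀ _ ht
  have hv : ∀ n, t₁ * K.v n = -(K.tr n * s₁) → K.v n - -s₁ / t₁ * K.tr n = 0 := by
    intro n h
    field_simp
    linarith
  have hs : ∀ i j, _ = (0 : ℝ) := fun i j => (H.shifted (-s₁ / t₁) i j).trans (by
    fin_cases i <;> fin_cases j <;> simp [tabV, tabT, hst])
  set u : Fin 7 → ℝ := fun n => K.v n - -s₁ / t₁ * K.tr n with hu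
  have u0 : u 0 = 0 := hv 0 (by simpa using hv0)
  have u1 : u 1 = 0 := by simp [hu, hv1, h1]
  have u2 : u 2 = 0 := by simp [hu, hv2, h2]
  have u3 : u 3 = 0 := hv 3 hv3
  change ∀ i j, K.tr i * u j - K.tr j * u i - K.brk u i j = 0 at hs
  have u4 : u 4 = 0 := by
    have := hs 0 4
    simpa [brk, htr, u0, u1, u2, u3, h0] using this
  have u6 : u 6 = 0 := by
    have := hs 0 6
    simp [brk, c0, d0, u0, u1] at this
    exact hz _ (by linarith)
  have hne : ∀ i, i ≠ 5 → u i = 0 := by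
    intro i hi
    fin_cases i <;> first | assumption | exact absurd rfl hi
  refine H.false_of_shifted ht h0 h2 hne (fun u5 => hn (sub_eq_zero.1 ?_)) hs
  by_cases h : n = 5
  · exact h ▸ u5
  · exact hne n h

end Coeffs.Facts

namespace Coeffs

variable {K : Coeffs} {s₁ s₂ t₁ : ℝ}

/-- The span of `e_1, e_2, e_3` is abelian. -/
def Abelian (K : Coeffs) : Prop :=
  (K.a 0 = 0 ∧ K.b 0 = 0 ∧ K.c 0 = 0 ∧ K.d 0 = 0) ∧ K.tr 1 = 0 ∧ K.tr 2 = 0 ∧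
    K.b 1 = K.a 2 ∧ K.d 1 = K.c 2

namespace Facts

theorem abelian_of_trace_eq_zero (H : K.Facts 0 s₁ s₂ t₁ 0) (hst : ¬(s₁ = 0 ∧ t₁ = 0))
    (hs₂ : K.tr 0 = 0 → K.b 0 ≠ 0 → s₂ = 0)
    (hE : ∀ x : Fin 7, x = 0 ∨ x = 1 ∨ x = 2 → K.a x = 0 ∧ K.c x = 0 ∧ K.d x = 0) :
    K.Abelian := by
  obtain ⟨ha0, hc0, hd0⟩ := hE 0 (by simp)
  obtain ⟨ha1, hc1, hd1⟩ := hE 1 (by simp)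
  obtain ⟨ha2, hc2, hd2⟩ := hE 2 (by simp)
  have hb1 : K.b 1 = 0 := by
    have := (H.flat 1 2 (by decide)).f12
    simpa [F12, brk, ha1, hd1, ha2, hc2, hd2] using this
  have hb0 : K.b 0 = 0 := by
    by_contra hb0
    obtain rfl := hs₂ (by simp [tr, ha0, hd0]) hb0
    exact H.false_of_trace_eq_zero hst ha0 hc0 hd0 ha1 hd1 ha2 hc2 hd2 hb1 hb0
  simp [Abelian, tr, *]

theorem exists_v_eq_mul_tr_of_s (H : K.Facts 0 s₁ 0 0 0) (hs : s₁ ≠ 0) (hK : ¬K.Abelian) :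
    ∃ k, ∀ i, K.v i = k * K.tr i := by
  refine H.v_eq_mul_tr_of_t_eq_zero hs fun ⟨h0, h1, h2⟩ => hK ?_
  refine H.abelian_of_trace_eq_zero (fun h => hs h.1) (fun _ _ => rfl) fun x hx => ?_
  obtain ⟨ha, hc, hd⟩ := H.recurrence_s hs hx
  rcases hx with rfl | rfl | rfl <;> simp_all

theorem exists_v_eq_mul_tr_of_t (H : K.Facts 0 s₁ s₂ t₁ 0) (ht : t₁ ≠ 0) (hK : ¬K.Abelian) :
    ∃ k, ∀ i, K.v i = k * K.tr i := by
  refine H.v_eq_mul_tr ht fun h0 => hK ?_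
  have h1 := H.tr_one_eq_zero ht h0
  have h2 := H.tr_two_eq_zero ht h0
  refine H.abelian_of_trace_eq_zero (fun h => ht h.2) (fun _ hb0 => ?_) fun x hx => ?_
  · have := (H.recurrence_s_of_t ht (x := 0) (by simp)).2
    simpa [h0, H.v_zero_of_tr_zero h0, hb0] using this
  · obtain ⟨ha, hc, hd⟩ := H.recurrence_t ht (x := x) (by tauto)
    rcases hx with rfl | rfl | rfl <;> simp_all

end Facts

end Coeffs

/-- The connection obtained from `L` by the change of basis `S` with inverse `T`. -/
def conjL (S T : M7) (L : V7 →ₗ[ℝ] M7) : V7 →ₗ[ℝ] M7 :=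
  LinearMap.mulLeft ℝ S ∘ₗ LinearMap.mulRight ℝ T ∘ₗ L ∘ₗ T.mulVecLin

/-- The bracket obtained from `bk` by the change of basis `S` with inverse `T`. -/
def conjBk (S T : M7) (bk : V7 → V7 → V7) (x y : V7) : V7 :=
  S.mulVec (bk (T.mulVec x) (T.mulVec y))

/-- The element of `SL(2)` with rows `(α, β)`, `(γ, δ)` acting on `ℝ^7`. -/
def sl2Mat (α β γ δ : ℝ) : M7 :=
  !![1, 0, 0, 0, 0, 0, 0;
     0, α, β, 0, 0, 0, 0;
     0, γ, δ, 0, 0, 0, 0;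
     0, 0, 0, 1, 0, 0, 0;
     0, 0, 0, 0, 1, 0, 0;
     0, 0, 0, 0, 0, δ, -γ;
     0, 0, 0, 0, 0, -β, α]

theorem sl2Mat_mul_sl2Mat {α β γ δ : ℝ} (h : α * δ - β * γ = 1) :
    sl2Mat α β γ δ * sl2Mat δ (-β) (-γ) α = 1 := by
  ext i j
  fin_cases i <;> fin_cases j <;>
    simp [sl2Mat, Matrix.mul_apply, Fin.sum_univ_seven] <;> linarith

theorem sl2Mat_mul_h3_mul_sl2Mat {α β γ δ : ℝ} (h : α * δ - β * γ = 1) (A : M2) (v : ℝ)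
    (y : Fin 2 → ℝ) :
    sl2Mat α β γ δ * h3 A v y * sl2Mat δ (-β) (-γ) α =
      h3 (!![α, β; γ, δ] * A * !![δ, -β; -γ, α]) v ![α * y 0 + β * y 1, γ * y 0 + δ * y 1] := by
  obtain ⟨B, hB⟩ : ∃ B, B = !![α, β; γ, δ] * A * !![δ, -β; -γ, α] := ⟨_, rfl⟩
  have hg : !![α, β; γ, δ] * !![δ, -β; -γ, α] = 1 := by
    ext i j
    fin_cases i <;> fin_cases j <;> simp [Matrix.mul_apply] <;> linarith
  have hg' := mul_eq_one_comm.1 hg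
  have htr : B 0 0 + B 1 1 = A 0 0 + A 1 1 := by
    rw [← Matrix.trace_fin_two, ← Matrix.trace_fin_two, hB, Matrix.trace_mul_comm,
      ← Matrix.mul_assoc, hg', Matrix.one_mul]
  have hBg : B * !![α, β; γ, δ] = !![α, β; γ, δ] * A := by
    rw [hB, Matrix.mul_assoc, hg', Matrix.mul_one]
  have hgB : !![δ, -β; -γ, α] * B = A * !![δ, -β; -γ, α] := by
    rw [hB, ← Matrix.mul_assoc, ← Matrix.mul_assoc, hg', Matrix.one_mul]
  have hBg' (i j) := congrFun (congrFun hBg i) j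
  have hgB' (i j) := congrFun (congrFun hgB i) j
  simp only [Matrix.mul_apply, Fin.sum_univ_two, Fin.forall_fin_two] at hBg' hgB'
  simp at hBg' hgB'
  have key : sl2Mat α β γ δ * h3 A v y =
      h3 B v ![α * y 0 + β * y 1, γ * y 0 + δ * y 1] * sl2Mat α β γ δ := by
    ext i j
    fin_cases i <;> fin_cases j <;>
      simp [sl2Mat, h3, hmat, Matrix.mul_apply, Fin.sum_univ_seven] <;>
        first | done | linarith | linear_combination y 0 * h | linear_combination y 1 * h
  rw [← hB]
  rw [key, Matrix.mul_assoc, sl2Mat_mul_sl2Mat h, Matrix.mul_one]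

namespace IsConn

variable {bk : V7 → V7 → V7} {L : V7 →ₗ[ℝ] M7} {S T : M7}

theorem curv_conj (hTS : T * S = 1) (x y : V7) :
    curv (conjL S T L) (conjBk S T bk) x y = S * curv L bk (T.mulVec x) (T.mulVec y) * T := by
  have h : ∀ A B : M7, S * (A * T) * (S * (B * T)) = S * (A * B) * T := fun A B => by
    rw [show S * (A * T) * (S * (B * T)) = S * A * (T * S) * (B * T) by noncomm_ring, hTS]
    noncomm_ring
  simp only [curv, conjL, conjBk, LinearMap.comp_apply, LinearMap.mulLeft_apply,
    LinearMap.mulRight_apply, Matrix.mulVecLin_apply, Matrix.mulVec_mulVec, h, hTS,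
    Matrix.one_mulVec]
  noncomm_ring

theorem conj (H : IsConn bk L) (hTS : T * S = 1) (hS : ∀ X ∈ hIII, S * X * T ∈ hIII) :
    IsConn (conjBk S T bk) (conjL S T L) where
  torsion x y := by
    simp [conjL, conjBk, ← H.torsion, ← Matrix.mulVec_mulVec, Matrix.mulVec_sub]
  jacobi x y z := by
    simp only [conjBk, Matrix.mulVec_mulVec, hTS, Matrix.one_mulVec, ← Matrix.mulVec_add,
      H.jacobi, Matrix.mulVec_zero]
  mem x := by
    rw [conjL]
    simpa [Matrix.mul_assoc] using hS _ (H.mem (T.mulVec x))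

theorem bk_comb (H : IsConn bk L) (α β γ δ : ℝ) (x y : V7) :
    bk (α • x + β • y) (γ • x + δ • y) = (α * δ - β * γ) • bk x y := by
  simp only [← H.torsion, map_add, map_smul, Matrix.add_mulVec, Matrix.mulVec_add,
    Matrix.smul_mulVec, Matrix.mulVec_smul]
  module

theorem curv_comb (H : IsConn bk L) (α β γ δ : ℝ) (x y : V7) :
    curv L bk (α • x + β • y) (γ • x + δ • y) = (α * δ - β * γ) • curv L bk x y := by
  simp only [curv, H.bk_comb, map_add, map_smul, add_mul, mul_add, smul_mul_assoc, mul_smul_comm]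
  module

end IsConn

theorem decomposable_of_mulVec_eq_zero {H : Set M7} {w : V7} (hw : ip w w ≠ 0)
    (h : ∀ X ∈ H, X.mulVec w = 0) : Decomposable H := by
  have hw0 : w ≠ 0 := by
    rintro rfl
    simp [ip] at hw
  refine ⟨Submodule.span ℝ {w}, by simpa using hw0, fun htop => ?_, fun X hX u hu => ?_,
    fun u hu h0 => ?_⟩
  · have := finrank_span_singleton (K := ℝ) hw0
    rw [htop, finrank_top] at this
    simp at this
  · obtain ⟨c, rfl⟩ := Submodule.mem_span_singleton.1 hu
    simp [Matrix.mulVec_smul, h X hX]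
  · obtain ⟨c, rfl⟩ := Submodule.mem_span_singleton.1 hu
    have := h0 w (Submodule.mem_span_singleton_self w)
    have h' : ip (c • w) w = c * ip w w := by
      simp only [ip, Pi.smul_apply, smul_eq_mul]
      ring
    rw [h'] at this
    simp [(mul_eq_zero.1 this).resolve_right hw]

/-- The bracket vanishes on the span of `e_1, e_2, e_3`. -/
def AbelianE (bk : V7 → V7 → V7) : Prop :=
  ∀ x y : V7, (∀ i, 3 ≤ i → x i = 0) → (∀ i, 3 ≤ i → y i = 0) → bk x y = 0

namespace IsConn

variable {bk : V7 → V7 → V7} {L : V7 →ₗ[ℝ] M7}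

theorem mulVec_eq_zero_of_v_eq (H : IsConn bk L) {k : ℝ}
    (hk : ∀ i, (coeffs L).v i = k * (coeffs L).tr i) (x : V7) :
    (L x).mulVec (e 3 - (√2 * k) • e 0) = 0 := by
  have h : ∀ i, (L (e i)).mulVec (e 3 - (√2 * k) • e 0) = 0 := by
    intro i
    rw [H.apply_e, Matrix.mulVec_sub, Matrix.mulVec_smul, mulVec_e, mulVec_e]
    ext m
    have hi := hk i
    rw [Coeffs.tr] at hi
    fin_cases m <;> simp [Coeffs.mat, h3, hmat, hi]
    ring
  rw [eq_sum_e x, map_sum, Matrix.sum_mulVec]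
  simp [Matrix.smul_mulVec, h]

theorem decomposable_of_mulVec_eq_zero {k : ℝ}
    (hk : ∀ x, (L x).mulVec (e 3 - k • e 0) = 0) : Decomposable (infHol L bk : Set M7) := by
  refine _root_.decomposable_of_mulVec_eq_zero (w := e 3 - k • e 0) (by simp [ip, e]) ?_
  generalize e 3 - k • e 0 = w at hk
  let N : Submodule ℝ M7 := LinearMap.ker ((Matrix.mulVecBilin ℝ ℝ).flip w)
  have hN : infHol L bk ≤ N := by
    refine sInf_le ⟨fun x y => ?_, fun z X hX => ?_⟩
    · simp [N, curv, Matrix.sub_mulVec, ← Matrix.mulVec_mulVec, hk]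
    · simp only [N, LinearMap.mem_ker, LinearMap.flip_apply, Matrix.mulVecBilin_apply] at hX ⊢
      simp [Matrix.sub_mulVec, ← Matrix.mulVec_mulVec, hk, hX]
  intro X hX
  simpa [N] using hN hX

theorem decomposable_of_curv (H : IsConn bk L) (hT : ∀ i j, (coeffs L).FT i j = 0)
    (hV : ∀ i j, (coeffs L).FV i j = 0) : Decomposable (infHol L bk : Set M7) := by
  refine _root_.decomposable_of_mulVec_eq_zero (w := e 3) (by simp [ip, e]) ?_
  let N : Submodule ℝ M7 := LinearMap.ker ((Matrix.mulVecBilin ℝ ℝ).flip (e 0)) ⊓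
    LinearMap.ker ((Matrix.mulVecBilin ℝ ℝ).flip (e 3))
  have mem_N : ∀ X : M7, X ∈ N ↔ X.mulVec (e 0) = 0 ∧ X.mulVec (e 3) = 0 := fun X => by
    simp [N]
  have basis_mem : ∀ i j, curv L bk (e i) (e j) ∈ N := by
    intro i j
    have ht := hT i j
    rw [Coeffs.FT] at ht
    rw [mem_N, H.curv_e, mulVec_e, mulVec_e, hV]
    constructor <;> ext m <;> fin_cases m <;> simp [h3, hmat, ht]
  have left_mem : ∀ x j, curv L bk x (e j) ∈ N := by
    intro x j
    change H.curvLin (e j) x ∈ N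
    rw [eq_sum_e x, map_sum]
    exact N.sum_mem fun i _ => by
      rw [map_smul]
      exact N.smul_mem _ (basis_mem i j)
  have curv_mem : ∀ x y, curv L bk x y ∈ N := by
    intro x y
    change H.curvLin y x ∈ N
    rw [eq_sum_e x, map_sum]
    refine N.sum_mem fun i _ => ?_
    rw [map_smul]
    refine N.smul_mem _ ?_
    change curv L bk (e i) y ∈ N
    rw [H.curv_swap y]
    exact N.neg_mem (left_mem y i)
  have hN : infHol L bk ≤ N := by
    refine sInf_le ⟨curv_mem, fun z X hX => ?_⟩
    obtain ⟨A, v, y, hA⟩ := H.mem z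
    have h0 : (L z).mulVec (e 0) = (A 0 0 + A 1 1) • e 0 := by
      rw [hA, mulVec_e]
      ext m
      fin_cases m <;> simp [h3, hmat, e]
    have h3' : (L z).mulVec (e 3) = (√2 * v) • e 0 := by
      rw [hA, mulVec_e]
      ext m
      fin_cases m <;> simp [h3, hmat, e]
    rw [mem_N] at hX ⊢
    simp [Matrix.sub_mulVec, ← Matrix.mulVec_mulVec, hX.1, hX.2, h0, h3', Matrix.mulVec_smul]
  exact fun X hX => ((mem_N X).1 (hN hX)).2

theorem abelianE_of_abelian (H : IsConn bk L) (hK : (coeffs L).Abelian) : AbelianE bk := by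
  obtain ⟨⟨a0, b0, c0, d0⟩, t1, t2, h1, h2⟩ := hK
  have v0 : (coeffs L).v 0 = 0 :=
    H.facts.v_zero_of_tr_zero (by rw [Coeffs.tr, a0, d0, add_zero])
  rw [Coeffs.tr] at t1 t2
  intro x y hx hy
  rw [← H.torsion, eq_sum_e x, eq_sum_e y]
  simp only [Fin.sum_univ_seven, hx 3 (by decide), hx 4 (by decide), hx 5 (by decide),
    hx 6 (by decide), hy 3 (by decide), hy 4 (by decide), hy 5 (by decide), hy 6 (by decide),
    zero_smul, add_zero, map_add, map_smul, Matrix.add_mulVec, Matrix.mulVec_add,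
    Matrix.smul_mulVec, Matrix.mulVec_smul, mulVec_e, H.apply_e]
  ext m
  fin_cases m <;> simp [Coeffs.mat, h3, hmat, a0, b0, c0, d0, t1, t2]
  · rw [h1]; ring
  · rw [h2]; ring

end IsConn

theorem sl2Mat_mulVec_e (α β γ δ : ℝ) :
    (sl2Mat α β γ δ).mulVec (e 0) = e 0 ∧
    (sl2Mat α β γ δ).mulVec (e 1) = α • e 1 + γ • e 2 ∧
    (sl2Mat α β γ δ).mulVec (e 2) = β • e 1 + δ • e 2 ∧
    (sl2Mat α β γ δ).mulVec (e 3) = e 3 ∧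
    (sl2Mat α β γ δ).mulVec (e 4) = e 4 ∧
    (sl2Mat α β γ δ).mulVec (e 5) = δ • e 5 + (-β) • e 6 ∧
    (sl2Mat α β γ δ).mulVec (e 6) = (-γ) • e 5 + α • e 6 := by
  simp only [mulVec_e]
  refine ⟨?_, ?_, ?_, ?_, ?_, ?_, ?_⟩ <;> ext m <;> fin_cases m <;> simp [sl2Mat, e]

theorem exists_sl2 {x₁ x₂ : ℝ} (hx : ¬(x₁ = 0 ∧ x₂ = 0)) :
    ∃ α β, α * x₁ - β * -x₂ = 1 := by
  have hn : x₁ ^ 2 + x₂ ^ 2 ≠ 0 := fun h =>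
    hx ⟨by nlinarith [sq_nonneg x₁, sq_nonneg x₂], by nlinarith [sq_nonneg x₁, sq_nonneg x₂]⟩
  refine ⟨x₁ / (x₁ ^ 2 + x₂ ^ 2), x₂ / (x₁ ^ 2 + x₂ ^ 2), ?_⟩
  field_simp
  ring

/-- The connection `L` in the coordinates changed by an element of `SL(2)`. -/
def gaugeL (α β γ δ : ℝ) (L : V7 →ₗ[ℝ] M7) : V7 →ₗ[ℝ] M7 :=
  conjL (sl2Mat α β γ δ) (sl2Mat δ (-β) (-γ) α) L

/-- The bracket `bk` in the coordinates changed by an element of `SL(2)`. -/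
def gaugeBk (α β γ δ : ℝ) (bk : V7 → V7 → V7) : V7 → V7 → V7 :=
  conjBk (sl2Mat α β γ δ) (sl2Mat δ (-β) (-γ) α) bk

namespace IsConn

variable {bk : V7 → V7 → V7} {L : V7 →ₗ[ℝ] M7} {α β γ δ : ℝ}

theorem gauge (H : IsConn bk L) (h : α * δ - β * γ = 1) :
    IsConn (gaugeBk α β γ δ bk) (gaugeL α β γ δ L) := by
  refine H.conj (mul_eq_one_comm.1 (sl2Mat_mul_sl2Mat h)) ?_
  rintro X ⟨A, v, y, rfl⟩
  exact ⟨_, _, _, sl2Mat_mul_h3_mul_sl2Mat h A v y⟩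

theorem coeffs_gauge_zero (H : IsConn bk L) (h : α * δ - β * γ = 1) :
    (coeffs (gaugeL α β γ δ L)).a 0 = δ * (α * (coeffs L).a 0 + β * (coeffs L).c 0) -
        γ * (α * (coeffs L).b 0 + β * (coeffs L).d 0) ∧
      (coeffs (gaugeL α β γ δ L)).b 0 = α * (α * (coeffs L).b 0 + β * (coeffs L).d 0) -
        β * (α * (coeffs L).a 0 + β * (coeffs L).c 0) ∧
      (coeffs (gaugeL α β γ δ L)).c 0 = δ * (γ * (coeffs L).a 0 + δ * (coeffs L).c 0) -
        γ * (γ * (coeffs L).b 0 + δ * (coeffs L).d 0) ∧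
      (coeffs (gaugeL α β γ δ L)).d 0 = α * (γ * (coeffs L).b 0 + δ * (coeffs L).d 0) -
        β * (γ * (coeffs L).a 0 + δ * (coeffs L).c 0) := by
  have h0 : gaugeL α β γ δ L (e 0) =
      sl2Mat α β γ δ * (coeffs L).mat 0 * sl2Mat δ (-β) (-γ) α := by
    rw [gaugeL, conjL, LinearMap.comp_apply, LinearMap.comp_apply, LinearMap.comp_apply,
      LinearMap.mulLeft_apply, LinearMap.mulRight_apply, Matrix.mulVecLin_apply,
      (sl2Mat_mulVec_e _ _ _ _).1, ← Matrix.mul_assoc, H.apply_e]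
  rw [Coeffs.mat, sl2Mat_mul_h3_mul_sl2Mat h] at h0
  have h0' (k l) := congrFun (congrFun h0 k) l
  rw [coeffs]
  simp only [h0']
  refine ⟨?_, ?_, ?_, ?_⟩ <;> simp [h3, hmat] <;> ring

theorem coeffs_gauge_bk (H : IsConn bk L) (h : α * δ - β * γ = 1) :
    (coeffs (gaugeL α β γ δ L)).b 1 - (coeffs (gaugeL α β γ δ L)).a 2 =
        α * ((coeffs L).b 1 - (coeffs L).a 2) + β * ((coeffs L).d 1 - (coeffs L).c 2) ∧
      (coeffs (gaugeL α β γ δ L)).d 1 - (coeffs (gaugeL α β γ δ L)).c 2 =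
        γ * ((coeffs L).b 1 - (coeffs L).a 2) + δ * ((coeffs L).d 1 - (coeffs L).c 2) := by
  have key : ∀ {bk L}, IsConn bk L →
      (coeffs L).b 1 - (coeffs L).a 2 = bk (e 1) (e 2) 1 ∧
      (coeffs L).d 1 - (coeffs L).c 2 = bk (e 1) (e 2) 2 := by
    intro bk L H
    rw [← H.torsion, mulVec_e, mulVec_e]
    exact ⟨rfl, rfl⟩
  have hb : bk (δ • e 1 + (-γ) • e 2) ((-β) • e 1 + α • e 2) = bk (e 1) (e 2) := by
    rw [H.bk_comb, show δ * α - -γ * -β = 1 by linarith, one_smul]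
  rw [(key (H.gauge h)).1, (key (H.gauge h)).2, (key H).1, (key H).2, gaugeBk, conjBk,
    (sl2Mat_mulVec_e _ _ _ _).2.1, (sl2Mat_mulVec_e _ _ _ _).2.2.1, hb]
  constructor <;> simp [sl2Mat, Matrix.mulVec, dotProduct, Fin.sum_univ_seven]

theorem gauge_facts (H : IsConn bk L) (h : α * δ - β * γ = 1) :
    (coeffs (gaugeL α β γ δ L)).Facts ((coeffs L).FV 5 6)
      (α * (coeffs L).FP 5 6 + β * (coeffs L).FQ 5 6)
      (γ * (coeffs L).FP 5 6 + δ * (coeffs L).FQ 5 6)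
      (α * (coeffs L).FP 0 4 + β * (coeffs L).FQ 0 4)
      (γ * (coeffs L).FP 0 4 + δ * (coeffs L).FQ 0 4) := by
  have hTS := mul_eq_one_comm.1 (sl2Mat_mul_sl2Mat h)
  have key : ∀ i j : Fin 7, curv L bk ((sl2Mat δ (-β) (-γ) α).mulVec (e i))
      ((sl2Mat δ (-β) (-γ) α).mulVec (e j)) = curv L bk (e i) (e j) →
      (coeffs (gaugeL α β γ δ L)).FV i j = (coeffs L).FV i j ∧
      (coeffs (gaugeL α β γ δ L)).FP i j = α * (coeffs L).FP i j + β * (coeffs L).FQ i j ∧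
      (coeffs (gaugeL α β γ δ L)).FQ i j = γ * (coeffs L).FP i j + δ * (coeffs L).FQ i j := by
    intro i j hij
    have h1 := (H.gauge h).curv_e i j
    rw [gaugeBk, gaugeL, curv_conj hTS, hij, H.curv_e, sl2Mat_mul_h3_mul_sl2Mat h] at h1
    rw [gaugeL]
    have h2 (k l) := congrFun (congrFun h1 k) l
    exact ⟨(h2 1 6).symm, (h2 1 4).symm, (h2 2 4).symm⟩
  have k56 := key 5 6 (by
    rw [(sl2Mat_mulVec_e _ _ _ _).2.2.2.2.2.1, (sl2Mat_mulVec_e _ _ _ _).2.2.2.2.2.2,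
      H.curv_comb, show α * δ - - -β * - -γ = 1 by linarith, one_smul])
  have k04 := key 0 4 (by
    rw [(sl2Mat_mulVec_e _ _ _ _).1, (sl2Mat_mulVec_e _ _ _ _).2.2.2.2.1])
  have hf := (H.gauge h).facts
  rwa [k56.1, k56.2.1, k56.2.2, k04.2.1, k04.2.2] at hf

theorem not_abelian_gauge (H : IsConn bk L) (h : α * δ - β * γ = 1) (hE : ¬AbelianE bk) :
    ¬(coeffs (gaugeL α β γ δ L)).Abelian := by
  refine fun hA => hE fun x y hx hy => ?_
  have hTS := mul_eq_one_comm.1 (sl2Mat_mul_sl2Mat h)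
  have hS : ∀ x : V7, (∀ i, 3 ≤ i → x i = 0) →
      ∀ i, 3 ≤ i → (sl2Mat α β γ δ).mulVec x i = 0 := by
    intro x hx i hi
    fin_cases i <;> first
      | exact absurd hi (by decide)
      | simp [sl2Mat, Matrix.mulVec, dotProduct, Fin.sum_univ_seven, hx 3 (by decide),
          hx 4 (by decide), hx 5 (by decide), hx 6 (by decide)]
  have h0 := (H.gauge h).abelianE_of_abelian hA _ _ (hS x hx) (hS y hy)
  rw [gaugeBk, conjBk, Matrix.mulVec_mulVec, Matrix.mulVec_mulVec, hTS, Matrix.one_mulVec,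
    Matrix.one_mulVec] at h0
  have := congrArg (sl2Mat δ (-β) (-γ) α).mulVec h0
  rwa [Matrix.mulVec_mulVec, hTS, Matrix.one_mulVec, Matrix.mulVec_zero] at this

theorem decomposable_of_gauge (H : IsConn bk L) (h : α * δ - β * γ = 1)
    (hk : ∃ k, ∀ i, (coeffs (gaugeL α β γ δ L)).v i = k * (coeffs (gaugeL α β γ δ L)).tr i) :
    Decomposable (infHol L bk : Set M7) := by
  obtain ⟨k, hk⟩ := hk
  have hTS := mul_eq_one_comm.1 (sl2Mat_mul_sl2Mat h)
  have hw : (sl2Mat δ (-β) (-γ) α).mulVec (e 3 - (√2 * k) • e 0) = e 3 - (√2 * k) • e 0 := by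
    rw [Matrix.mulVec_sub, Matrix.mulVec_smul, (sl2Mat_mulVec_e _ _ _ _).1,
      (sl2Mat_mulVec_e _ _ _ _).2.2.2.1]
  refine decomposable_of_mulVec_eq_zero (k := √2 * k) fun x => ?_
  have h0 := congrArg (sl2Mat δ (-β) (-γ) α).mulVec
    ((H.gauge h).mulVec_eq_zero_of_v_eq hk ((sl2Mat α β γ δ).mulVec x))
  generalize e 3 - (√2 * k) • e 0 = w at hw h0
  have hc (u : V7) : (sl2Mat δ (-β) (-γ) α).mulVec ((sl2Mat α β γ δ).mulVec u) = u := by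
    rw [Matrix.mulVec_mulVec, hTS, Matrix.one_mulVec]
  simpa only [gaugeL, conjL, LinearMap.comp_apply, LinearMap.mulLeft_apply,
    LinearMap.mulRight_apply, Matrix.mulVecLin_apply, ← Matrix.mulVec_mulVec, hw, hc,
    Matrix.mulVec_zero] using h0

theorem FV_five_six_eq_zero (H : IsConn bk L) (hE : ¬AbelianE bk) : (coeffs L).FV 5 6 = 0 := by
  by_contra hr
  obtain ⟨d0, d1, d2, -, -⟩ := H.facts.trace_eq_zero hr
  have hdet : (coeffs L).a 0 * (coeffs L).d 0 - (coeffs L).b 0 * (coeffs L).c 0 = 0 := by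
    by_contra hdet
    exact H.facts.false_of_det_ne_zero hr hdet
  by_cases hA : (coeffs L).a 0 = 0 ∧ (coeffs L).b 0 = 0 ∧ (coeffs L).c 0 = 0
  · obtain ⟨a0, b0, c0⟩ := hA
    have hκ : ¬((coeffs L).b 1 - (coeffs L).a 2 = 0 ∧ (coeffs L).d 1 - (coeffs L).c 2 = 0) :=
      fun h => hE (H.abelianE_of_abelian ⟨⟨a0, b0, c0, by rw [d0, a0, neg_zero]⟩,
        by rw [Coeffs.tr, d1, add_neg_cancel], by rw [Coeffs.tr, d2, add_neg_cancel],
        by linarith [h.1], by linarith [h.2]⟩)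
    obtain ⟨α, β, h⟩ := exists_sl2 hκ
    obtain ⟨a0', b0', c0', -⟩ := H.coeffs_gauge_zero h
    obtain ⟨h1, h2⟩ := H.coeffs_gauge_bk h
    rw [d0, a0, b0, c0] at a0' b0' c0'
    simp only [mul_zero, neg_zero, add_zero, sub_zero] at a0' b0' c0'
    refine (H.gauge_facts h).false_of_A₀_eq_zero hr a0' b0' c0' ?_ fun h3 => ?_
    · linarith
    · linarith
  · obtain ⟨x₁, x₂, hx, h1, h2⟩ : ∃ x₁ x₂, ¬(x₁ = 0 ∧ x₂ = 0) ∧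
        (coeffs L).a 0 * x₁ + (coeffs L).b 0 * x₂ = 0 ∧
        (coeffs L).c 0 * x₁ + (coeffs L).d 0 * x₂ = 0 := by
      by_cases hab : (coeffs L).b 0 = 0 ∧ -(coeffs L).a 0 = 0
      · refine ⟨0, 1, by simp, by simp [hab.1], by simp [d0, hab.2]⟩
      · exact ⟨_, _, hab, by ring, by linarith⟩
    obtain ⟨α, β, h⟩ := exists_sl2 hx
    obtain ⟨a0', b0', c0', d0'⟩ := H.coeffs_gauge_zero h
    have a0'' : (coeffs (gaugeL α β (-x₂) x₁ L)).a 0 = 0 := by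
      linear_combination a0' + α * h1 + β * h2
    have c0'' : (coeffs (gaugeL α β (-x₂) x₁ L)).c 0 = 0 := by
      linear_combination c0' - x₂ * h1 + x₁ * h2
    have d0'' := ((H.gauge_facts h).trace_eq_zero hr).1
    rw [a0'', neg_zero] at d0''
    refine (H.gauge_facts h).false_of_nilpotent hr a0'' c0'' fun b0'' => hA ?_
    rw [a0''] at a0'
    rw [b0''] at b0'
    rw [c0''] at c0'
    rw [d0''] at d0'
    refine ⟨?_, ?_, ?_⟩
    · linear_combination -x₁ * (α * a0' - x₂ * b0') + β * (α * c0' - x₂ * d0') -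
        (coeffs L).a 0 * (α * x₁ - β * -x₂ + 1) * h
    · linear_combination -x₁ * (β * a0' + x₁ * b0') + β * (β * c0' + x₁ * d0') -
        (coeffs L).b 0 * (α * x₁ - β * -x₂ + 1) * h
    · linear_combination -x₂ * (α * a0' - x₂ * b0') - α * (α * c0' - x₂ * d0') -
        (coeffs L).c 0 * (α * x₁ - β * -x₂ + 1) * h

theorem decomposable_of_not_abelianE (H : IsConn bk L) (hE : ¬AbelianE bk) :
    Decomposable (infHol L bk : Set M7) := by
  have hr := H.FV_five_six_eq_zero hE
  by_cases ht : (coeffs L).FP 0 4 = 0 ∧ (coeffs L).FQ 0 4 = 0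
  · by_cases hs : (coeffs L).FP 5 6 = 0 ∧ (coeffs L).FQ 5 6 = 0
    · have hf := H.facts
      rw [hr, ht.1, ht.2, hs.1, hs.2] at hf
      refine H.decomposable_of_curv (fun i j => ?_) fun i j => ?_
      · rw [hf.ft]
        fin_cases i <;> fin_cases j <;> simp [Coeffs.tabT]
      · rw [hf.fv]
        fin_cases i <;> fin_cases j <;> simp [Coeffs.tabV]
    · obtain ⟨α, β, h⟩ := exists_sl2 hs
      refine H.decomposable_of_gauge h ?_
      have hf := H.gauge_facts h
      have h2 : ∀ x y : ℝ, -y * x + x * y = 0 := fun x y => by ring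
      rw [hr, ht.1, ht.2, h2] at hf
      simp only [mul_zero, add_zero] at hf
      exact hf.exists_v_eq_mul_tr_of_s (fun h0 => by linarith) (H.not_abelian_gauge h hE)
  · obtain ⟨α, β, h⟩ := exists_sl2 ht
    refine H.decomposable_of_gauge h ?_
    have hf := H.gauge_facts h
    have h2 : ∀ x y : ℝ, -y * x + x * y = 0 := fun x y => by ring
    rw [hr, h2 ((coeffs L).FP 0 4)] at hf
    exact hf.exists_v_eq_mul_tr_of_t (fun h0 => by linarith) (H.not_abelian_gauge h hE)

end IsConn

theorem stmt10 (bk : V7 → V7 → V7) (L : V7 →ₗ[ℝ] M7)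
    (hbk : ∀ x y : V7, (L x).mulVec y - (L y).mulVec x = bk x y)
    (halt : ∀ x : V7, bk x x = 0)
    (hjac : ∀ x y z : V7, bk (bk x y) z + bk (bk y z) x + bk (bk z x) y = 0)
    (hL : ∀ x, L x ∈ hIII)
    (h : ∃ i j : Fin 7, i.val < 3 ∧ j.val < 3 ∧ bk (e i) (e j) ≠ 0) :
    Decomposable (infHol L bk : Set M7) ∨
    (∀ i : Fin 7, proA (L (e i)) 1 0 = 0) ∨
    (∀ i : Fin 7, proA (L (e i)) 0 1 = 0) := by
  have H : IsConn bk L := ⟨hbk, hjac, hL⟩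
  refine Or.inl (H.decomposable_of_not_abelianE fun hE => ?_)
  obtain ⟨i, j, hi, hj, hij⟩ := h
  have he : ∀ i : Fin 7, i.val < 3 → ∀ k : Fin 7, 3 ≤ k → e i k = 0 := by
    intro i hi k hk
    refine Pi.single_eq_of_ne ?_ _
    rintro rfl
    exact absurd (Fin.le_def.1 hk) (by simpa using hi)
  exact hij (hE _ _ (he i hi) (he j hj))
end
end

section
/- Suppose [·,·] is a Lie bracket on ℝ^7 and Λ : ℝ^7 → 𝔤𝔩(7,ℝ) is a linear map with Λ(x)y − Λ(y)x = [x,y] and Λ(x) ∈ 𝔤₂* for all x,y ∈ ℝ^7, and suppose the infinitesimal holonomy 𝔥 equals 𝔞 ⋉ 𝔪(1,0,k), one of the listed type III algebras. Then: (1) if 𝔞 ∈ {𝔰𝔩(2,ℝ), 𝔤𝔩(2,ℝ), 𝔠𝔬(2), 𝔡} (with k = 2), every Λ(x) lies in 𝔥^III, and moreover if 𝔞 ∈ {𝔤𝔩(2,ℝ), 𝔠𝔬(2), 𝔡} then pro_A(Λ(x)) ∈ 𝔞 for all x ∈ ℝ^7; (2) if 𝔞 = ℝ·diag(1,0), then every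 Λ(x) is of the form h(A,v,u,y) with A ∈ 𝔡 and u = (0,u_2). -/
open Matrix

noncomputable section

/-- The matrix `X(s)` (indices shifted: `s 0 = s_1`, …, `s 13 = s_14`). -/
def Xg2 (s : Fin 14 → ℝ) : M7 :=
  !![s 0 + s 3, -s 9, s 8, Real.sqrt 2 * s 5, 0, -s 10, -s 11;
     -s 7, s 0, s 1, Real.sqrt 2 * s 8, s 10, 0, s 5;
     s 6, s 2, s 3, Real.sqrt 2 * s 9, s 11, -s 5, 0;
     Real.sqrt 2 * s 4, Real.sqrt 2 * s 6, Real.sqrt 2 * s 7, 0,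
       Real.sqrt 2 * s 5, Real.sqrt 2 * s 8, Real.sqrt 2 * s 9;
     0, s 12, s 13, Real.sqrt 2 * s 4, -s 0 - s 3, s 7, -s 6;
     -s 12, 0, -s 4, Real.sqrt 2 * s 6, s 9, -s 0, -s 2;
     -s 13, s 4, 0, Real.sqrt 2 * s 7, -s 8, -s 1, -s 3]

/-- `𝔤₂* = {X(s) : s ∈ ℝ^14}`. -/
def g2star : Set M7 := Set.range Xg2

/-- `𝔰𝔩(2,ℝ)` as a set of 2×2 matrices. -/
def sl2 : Set M2 := {A | A 0 0 + A 1 1 = 0}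

/-- `𝔤𝔩(2,ℝ)` as a set of 2×2 matrices. -/
def gl2 : Set M2 := Set.univ

/-- `𝔠𝔬(2) = {(a,−b;b,a)}`. -/
def co2 : Set M2 := {A | ∃ a b : ℝ, A = !![a, -b; b, a]}

/-- `𝔡`, the diagonal 2×2 matrices. -/
def dd : Set M2 := {A | A 0 1 = 0 ∧ A 1 0 = 0}

/-- `ℝ·diag(1,0)`. -/
def rdiag10 : Set M2 := {A | ∃ t : ℝ, A = !![t, 0; 0, 0]}

/-- `𝔞 ⋉ 𝔪(1,0,k)`. -/
def semidir (a : Set M2) : ℕ → Set M7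
  | 1 => {X | ∃ A ∈ a, ∃ v y1, X = h3 A v ![y1, 0]}
  | _ => {X | ∃ A ∈ a, ∃ v y, X = h3 A v y}

/-- The pairs `(𝔞, k)` occurring in the list of type III holonomy algebras. -/
def ListedPair (a : Set M2) (k : ℕ) : Prop :=
  ((a = sl2 ∨ a = gl2 ∨ a = co2 ∨ a = dd) ∧ k = 2) ∨
  ((a = ({0} : Set M2) ∨ a = rdiag10) ∧ (k = 1 ∨ k = 2))

/-- The listed type III holonomy algebras `𝔞 ⋉ 𝔪(1,0,k)`. -/
def ListedTypeIII (S : Set M7) : Prop := ∃ a k, ListedPair a k ∧ S = semidir a k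

/-- The stability of the infinitesimal holonomy under bracketing with `Λ(z)`. -/
theorem bracket_mem_infHol (L : V7 →ₗ[ℝ] M7) (bk : V7 → V7 → V7) (z : V7) {X : M7}
    (hX : X ∈ infHol L bk) : L z * X - X * L z ∈ infHol L bk := by
  rw [infHol, Submodule.mem_sInf] at hX ⊢
  exact fun H hH => hH.2 z X (hX H hH)

theorem semidir_subset_hIII (a : Set M2) (k : ℕ) : semidir a k ⊆ hIII := by
  intro X hX
  unfold semidir at hX
  split at hX
  · obtain ⟨A, -, v, y, rfl⟩ := hX
    exact ⟨A, v, _, rfl⟩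
  · obtain ⟨A, -, v, y, rfl⟩ := hX
    exact ⟨A, v, y, rfl⟩

theorem proA_hmat (A : M2) (v : ℝ) (u y : Fin 2 → ℝ) : proA (hmat A v u y) = A := by
  ext i j
  fin_cases i <;> fin_cases j <;> simp [proA, hmat]

theorem proA_mem_of_mem_semidir {a : Set M2} {k : ℕ} {X : M7} (hX : X ∈ semidir a k) :
    proA X ∈ a := by
  unfold semidir at hX
  split at hX
  · obtain ⟨A, hA, v, y, rfl⟩ := hX
    rwa [h3, proA_hmat]
  · obtain ⟨A, hA, v, y, rfl⟩ := hX
    rwa [h3, proA_hmat]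

theorem h3_mem_semidir {a : Set M2} {A : M2} (hA : A ∈ a) (k : ℕ) (v t : ℝ) :
    h3 A v ![t, 0] ∈ semidir a k := by
  unfold semidir
  split
  · exact ⟨A, hA, v, t, rfl⟩
  · exact ⟨A, hA, v, _, rfl⟩

/-- An element of `𝔤₂*` whose brackets with `h(0,1,0)` and `h(0,0,(1,0))` lie in `𝔥^III`
belongs to `𝔥^I`. -/
theorem mem_hI_of_bracket_mem_hIII {X : M7} (hX : X ∈ g2star)
    (hv : X * h3 0 1 ![0, 0] - h3 0 1 ![0, 0] * X ∈ hIII)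
    (hy : X * h3 0 0 ![1, 0] - h3 0 0 ![1, 0] * X ∈ hIII) : X ∈ hI := by
  have key : ∀ {Y : M7}, Y ∈ hIII →
      Y 3 1 = 0 ∧ Y 3 2 = 0 ∧ Y 1 3 = 0 ∧ Y 2 3 = 0 := by
    rintro Y ⟨A, v, y, rfl⟩
    simp [h3, hmat]
  obtain ⟨s, rfl⟩ := hX
  obtain ⟨h12, h13, h7, h6⟩ := key hv
  obtain ⟨-, -, h4, -⟩ := key hy
  simp [Xg2, h3, hmat] at h12 h13 h7 h6 h4
  have hs : √2 ≠ 0 := by positivity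
  replace h7 : s 7 = 0 :=
    (mul_eq_zero_iff_left hs).mp (by linarith : √2 * s 7 = 0)
  replace h6 : s 6 = 0 :=
    (mul_eq_zero_iff_left hs).mp (by linarith : √2 * s 6 = 0)
  refine ⟨!![s 0, s 1; s 2, s 3], s 5, ![s 8, s 9], ![s 10, s 11], ?_⟩
  simp only [Xg2, hmat, h12, h13, h7, h6, h4]
  ext i j
  fin_cases i <;> fin_cases j <;> simp
  ring

theorem apply_bracket_hmat_h3 (A B : M2) (v : ℝ) (u y : Fin 2 → ℝ) :
    let Z := hmat A v u y * h3 B 0 ![0, 0] - h3 B 0 ![0, 0] * hmat A v u y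
    proA Z = A * B - B * A ∧ Z 0 1 = u 0 * B 1 0 + u 1 * B 1 1 ∧
      Z 0 2 = -(u 0 * B 0 0 + u 1 * B 0 1) := by
  refine ⟨?_, ?_, ?_⟩
  · ext i j
    fin_cases i <;> fin_cases j <;> simp [proA, h3, hmat, Matrix.mul_apply]
  · simp [h3, hmat]
    ring
  · simp [h3, hmat]
    ring

/-- If the infinitesimal holonomy is `𝔞 ⋉ 𝔪(1,0,k)`, then every `Λ(x)` lies in `𝔥^I`, its
`A`-component normalizes `𝔞`, and its `u`-component is annihilated by `𝔞`. -/
theorem exists_eq_hmat_of_infHol_eq_semidir {bk : V7 → V7 → V7} {L : V7 →ₗ[ℝ] M7}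
    (hL : ∀ x, L x ∈ g2star) {a : Set M2} {k : ℕ} (h0 : 0 ∈ a)
    (hH : (infHol L bk : Set M7) = semidir a k) (x : V7) :
    ∃ (A : M2) (v : ℝ) (u y : Fin 2 → ℝ), L x = hmat A v u y ∧
      ∀ B ∈ a, A * B - B * A ∈ a ∧ u 0 * B 1 0 + u 1 * B 1 1 = 0 ∧
        u 0 * B 0 0 + u 1 * B 0 1 = 0 := by
  have hbr : ∀ X ∈ semidir a k, L x * X - X * L x ∈ semidir a k := by
    rw [← hH]
    exact fun X hX => bracket_mem_infHol L bk x hX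
  obtain ⟨A, v, u, y, hX⟩ := mem_hI_of_bracket_mem_hIII (hL x)
    (semidir_subset_hIII a k (hbr _ (h3_mem_semidir h0 k 1 0)))
    (semidir_subset_hIII a k (hbr _ (h3_mem_semidir h0 k 0 1)))
  refine ⟨A, v, u, y, hX, fun B hB => ?_⟩
  have hZ := hbr _ (h3_mem_semidir hB k 0 0)
  rw [hX] at hZ
  obtain ⟨hA, h1, h2⟩ := apply_bracket_hmat_h3 A B v u y
  have hzero : ∀ {Y : M7}, Y ∈ hIII → Y 0 1 = 0 ∧ Y 0 2 = 0 := by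
    rintro Y ⟨A, v, y, rfl⟩
    simp [h3, hmat]
  obtain ⟨z1, z2⟩ := hzero (semidir_subset_hIII a k hZ)
  refine ⟨hA ▸ proA_mem_of_mem_semidir hZ, h1 ▸ z1, ?_⟩
  linarith

theorem stmt11 (bk : V7 → V7 → V7) (L : V7 →ₗ[ℝ] M7)
    (hbk : ∀ x y : V7, (L x).mulVec y - (L y).mulVec x = bk x y)
    (halt : ∀ x : V7, bk x x = 0)
    (hjac : ∀ x y z : V7, bk (bk x y) z + bk (bk y z) x + bk (bk z x) y = 0)
    (hL : ∀ x, L x ∈ g2star) :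
    (∀ a : Set M2, (a = sl2 ∨ a = gl2 ∨ a = co2 ∨ a = dd) →
      (infHol L bk : Set M7) = semidir a 2 →
      (∀ x, L x ∈ hIII) ∧
      ((a = gl2 ∨ a = co2 ∨ a = dd) → ∀ x, proA (L x) ∈ a)) ∧
    (∀ k : ℕ, (k = 1 ∨ k = 2) → (infHol L bk : Set M7) = semidir rdiag10 k →
      ∀ x, ∃ (A : M2) (v : ℝ) (u y : Fin 2 → ℝ),
        L x = hmat A v u y ∧ A 0 1 = 0 ∧ A 1 0 = 0 ∧ u 0 = 0) := by
  refine ⟨fun a ha hH => ?_, fun k _ hH x => ?_⟩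
  · have h0 : (0 : M2) ∈ a := by
      rcases ha with rfl | rfl | rfl | rfl
      · simp [sl2]
      · simp [gl2]
      · exact ⟨0, 0, by ext i j; fin_cases i <;> fin_cases j <;> simp⟩
      · simp [dd]
    refine ⟨fun x => ?_, fun ha' x => ?_⟩
    · obtain ⟨A, v, u, y, hX, hB⟩ := exists_eq_hmat_of_infHol_eq_semidir hL h0 hH x
      have hdiag : ∃ t : ℝ, t ≠ 0 ∧ !![1, 0; 0, t] ∈ a := by
        rcases ha with rfl | rfl | rfl | rfl
        · exact ⟨-1, by norm_num, by simp [sl2]⟩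
        · exact ⟨1, one_ne_zero, by simp [gl2]⟩
        · exact ⟨1, one_ne_zero, 1, 0, by simp⟩
        · exact ⟨1, one_ne_zero, by simp [dd]⟩
      obtain ⟨t, ht, hmem⟩ := hdiag
      obtain ⟨-, h1, h2⟩ := hB _ hmem
      have hu : u = 0 := by
        ext i
        fin_cases i
        · simpa using h2
        · simpa [ht] using h1
      exact ⟨A, v, y, by rw [hX, hu, h3]⟩
    · obtain ⟨A, v, u, y, hX, hB⟩ := exists_eq_hmat_of_infHol_eq_semidir hL h0 hH x
      rw [hX, proA_hmat]
      rcases ha' with rfl | rfl | rfl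
      · exact Set.mem_univ A
      · obtain ⟨⟨p, q, hpq⟩, -⟩ := hB !![0, -1; 1, 0] ⟨0, 1, rfl⟩
        have e00 := congrFun₂ hpq 0 0
        have e01 := congrFun₂ hpq 0 1
        have e10 := congrFun₂ hpq 1 0
        have e11 := congrFun₂ hpq 1 1
        simp [Matrix.mul_apply, Matrix.vecMul_eq_sum] at e00 e01 e10 e11
        refine ⟨A 0 0, A 1 0, ?_⟩
        ext i j
        fin_cases i <;> fin_cases j <;> simp <;> linarith
      · obtain ⟨⟨h1, h2⟩, -⟩ := hB !![1, 0; 0, 0] (by simp [dd])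
        simp [Matrix.mul_apply, Matrix.vecMul_eq_sum] at h1 h2
        exact ⟨h1, h2⟩
  · have h0 : (0 : M2) ∈ rdiag10 :=
      ⟨0, by ext i j; fin_cases i <;> fin_cases j <;> simp⟩
    obtain ⟨A, v, u, y, hX, hB⟩ := exists_eq_hmat_of_infHol_eq_semidir hL h0 hH x
    obtain ⟨⟨t, ht⟩, -, hu⟩ := hB !![1, 0; 0, 0] ⟨1, rfl⟩
    have e01 := congrFun₂ ht 0 1
    have e10 := congrFun₂ ht 1 0
    simp [Matrix.mul_apply, Matrix.vecMul_eq_sum] at e01 e10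
    exact ⟨A, v, u, y, hX, e01, e10, by simpa using hu⟩
end
end
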